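/- arXiv:2409.06027 — 2 statements merged into one kernel-verified Lean document; each statement's English description precedes it below -/
import Mathlib

section
/- Let p be a prime and θ as below. Let R = { (a,b,c,x) ∈ ℚ_p⁴ : min{v_p(a), v_p(b), v_p(c)} > v_p(ac − b²), v_p(b + cx) ≤ v_p(a + bx), and b + cx ≠ 0 } (so in particular ac − b² ≠ 0 on R; the set where b + cx = 0 has measure zero). There exists T ∈ ℝ such that for all ν₁, ν₂ ∈ ℂ with Re(ν₂) > T and Re(ν₁ − ν₂) > T, the function (a,b,c,x) ↦ |b + cx|^{−1−ν₁+ν₂} · |ac − b²|^{−1−ν₂} · θ(−x − c) is absolutely integrable on R and ∫_R |b + cx|^{−1−ν₁+ν₂} |ac − b²|^{−1−ν₂} θ(−x − c) da db dc dx = (1 − p⁻¹)·p^{−2−ν₁−ν₂} + (1 − p⁻¹)·p^{−2−2ν₁−ν₂} + (1 − p⁻¹)·p^{−2−2ν₁} − p^{−3−2ν₁−2ν₂}. -/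
open MeasureTheory
open scoped ENNReal NNReal Pointwise

namespace PadicIntegral

variable {p : ℕ} [hp : Fact p.Prime]

lemma one_lt_cast : (1 : ℝ) < p := mod_cast hp.out.one_lt

lemma cast_pos : (0 : ℝ) < p := mod_cast hp.out.pos

lemma norm_le_inv_of_lt_one {z : ℚ_[p]} (h : ‖z‖ < 1) : ‖z‖ ≤ (p : ℝ)⁻¹ := by
  have := (Padic.norm_lt_pow_iff_norm_le_pow_sub_one z 0).1 (by simpa using h)
  simpa using this

lemma norm_le_one_of_lt {z : ℚ_[p]} (h : ‖z‖ < p) : ‖z‖ ≤ 1 := by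
  have := (Padic.norm_lt_pow_iff_norm_le_pow_sub_one z 1).1 (by simpa using h)
  simpa using this

lemma addValuation_lt_iff {x y : ℚ_[p]} :
    Padic.addValuation x < Padic.addValuation y ↔ ‖y‖ < ‖x‖ := by
  have h1 := one_lt_cast (p := p)
  rcases eq_or_ne x 0 with rfl | hx
  · simp
  rcases eq_or_ne y 0 with rfl | hy
  · simp [hx, Padic.addValuation.apply hx]
  rw [Padic.addValuation.apply hx, Padic.addValuation.apply hy,
    Padic.norm_eq_zpow_neg_valuation hx, Padic.norm_eq_zpow_neg_valuation hy,
    zpow_lt_zpow_iff_right₀ h1, WithTop.coe_lt_coe]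
  omega

lemma addValuation_le_iff {x y : ℚ_[p]} :
    Padic.addValuation x ≤ Padic.addValuation y ↔ ‖y‖ ≤ ‖x‖ := by
  rw [← not_lt, ← not_lt, addValuation_lt_iff]

lemma norm_add_eq_of_lt {x y : ℚ_[p]} (h : ‖y‖ < ‖x‖) : ‖x + y‖ = ‖x‖ := by
  rw [Padic.add_eq_max_of_ne h.ne', max_eq_left h.le]

lemma norm_cases (z : ℚ_[p]) :
    (p : ℝ) < ‖z‖ ∨ ‖z‖ = p ∨ ‖z‖ = 1 ∨ ‖z‖ = (p : ℝ)⁻¹ ∨ ‖z‖ ≤ ((p : ℝ) ^ 2)⁻¹ := by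
  have h1 := Padic.norm_lt_pow_iff_norm_le_pow_sub_one z 1
  have h2 := Padic.norm_lt_pow_iff_norm_le_pow_sub_one z 0
  have h3 := Padic.norm_lt_pow_iff_norm_le_pow_sub_one z (-1)
  have e1 : (p : ℝ) ^ (-1 - 1 : ℤ) = ((p : ℝ) ^ 2)⁻¹ := by
    rw [show (-1 - 1 : ℤ) = -((2 : ℕ) : ℤ) by norm_num, zpow_neg, zpow_natCast]
  rw [e1] at h3
  simp only [zpow_one, sub_self, zpow_zero, zero_sub, zpow_neg] at h1 h2 h3
  rcases lt_trichotomy ‖z‖ p with h | h | h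
  · rcases (h1.1 h).lt_or_eq with h | h
    · rcases (h2.1 h).lt_or_eq with h | h
      · exact .inr (.inr (.inr (.inr (h3.1 h))))
      · exact .inr (.inr (.inr (.inl h)))
    · exact .inr (.inr (.inl h))
  · exact .inr (.inl h)
  · exact .inl h

lemma mem_units_smul_set {u : ℚ_[p]ˣ} {S : Set ℚ_[p]} {x : ℚ_[p]} :
    x ∈ u • S ↔ (u : ℚ_[p])⁻¹ * x ∈ S := by
  rw [Set.mem_smul_set_iff_inv_smul_mem, Units.smul_def, Units.val_inv_eq_inv_val, smul_eq_mul]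

section Algebra

variable {s u c x : ℚ_[p]}

lemma norm_add_lt {x y : ℚ_[p]} {r : ℝ} (hx : ‖x‖ < r) (hy : ‖y‖ < r) : ‖x + y‖ < r :=
  (Padic.nonarchimedean x y).trans_lt (max_lt hx hy)

lemma region_iff (hu : u ≠ 0) :
    (‖u * (c * s - u)‖ > max ‖u * (s - 2 * x) + c * x ^ 2‖ (max ‖u - c * x‖ ‖c‖) ∧
      ‖u * (s - x)‖ ≤ ‖u‖) ↔
    ‖s - x‖ ≤ 1 ∧ 1 < ‖u‖ ∧ ‖s‖ < ‖u‖ ∧ ‖c‖ < ‖u‖ * ‖c * s - u‖ := by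
  have hu' := norm_pos_iff.2 hu
  rw [and_comm, norm_mul u (s - x), mul_le_iff_le_one_right hu', norm_mul]
  refine and_congr_right fun ht => ?_
  obtain ⟨t, rfl⟩ : ∃ t, x = s - t := ⟨s - x, by ring⟩
  rw [sub_sub_cancel] at ht
  generalize hw : c * s - u = w
  obtain rfl : u = c * s - w := by rw [← hw]; ring
  have ea : (c * s - w) * (s - 2 * (s - t)) + c * (s - t) ^ 2 =
      w * s + (-(2 * t * w) + c * t ^ 2) := by ring
  have eb : c * s - w - c * (s - t) = -w + c * t := by ring
  have h2 : ‖(2 : ℚ_[p])‖ ≤ 1 := by simpa using Padic.norm_int_le_one (p := p) 2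
  have ht2 : ‖-(2 * t * w)‖ ≤ ‖w‖ := by
    rw [norm_neg, norm_mul, norm_mul]
    exact mul_le_of_le_one_left (norm_nonneg _) (mul_le_one₀ h2 (norm_nonneg _) ht)
  have hct : ‖c * t‖ ≤ ‖c‖ := by
    rw [norm_mul]; exact mul_le_of_le_one_right (norm_nonneg _) ht
  have hct2 : ‖c * t ^ 2‖ ≤ ‖c‖ := by
    rw [norm_mul, norm_pow]
    exact mul_le_of_le_one_right (norm_nonneg _) (pow_le_one₀ (norm_nonneg _) ht)
  rw [ea, eb, gt_iff_lt, max_lt_iff, max_lt_iff]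
  set u := c * s - w
  constructor
  · rintro ⟨ha, hb, hc⟩
    have hw0 : 0 < ‖w‖ := by
      refine (norm_nonneg w).lt_of_ne fun h => ?_
      rw [← h, mul_zero] at hc
      exact absurd hc (norm_nonneg c).not_gt
    have hwE : ‖w‖ < ‖u‖ * ‖w‖ := by
      calc ‖w‖ = ‖-(-w + c * t) + c * t‖ := by congr 1; ring
        _ < ‖u‖ * ‖w‖ := norm_add_lt (by rwa [norm_neg]) (hct.trans_lt hc)
    refine ⟨?_, ?_, hc⟩
    · exact lt_of_mul_lt_mul_right (by rwa [one_mul]) hw0.le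
    · have : ‖w * s‖ < ‖u‖ * ‖w‖ := by
        have : w * s = (w * s + (-(2 * t * w) + c * t ^ 2)) + -(-(2 * t * w) + c * t ^ 2) := by ring
        rw [this]
        refine norm_add_lt ha ?_
        rw [norm_neg]
        exact norm_add_lt (ht2.trans_lt hwE) (hct2.trans_lt hc)
      rw [norm_mul, mul_comm] at this
      exact lt_of_mul_lt_mul_right this hw0.le
  · rintro ⟨h1, hs, hc⟩
    have hw0 : 0 < ‖w‖ := by
      refine (norm_nonneg w).lt_of_ne fun h => ?_
      rw [← h, mul_zero] at hc
      exact absurd hc (norm_nonneg c).not_gt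
    have hwE : ‖w‖ < ‖u‖ * ‖w‖ := lt_mul_of_one_lt_left hw0 h1
    refine ⟨norm_add_lt ?_ (norm_add_lt (ht2.trans_lt hwE) (hct2.trans_lt hc)),
      norm_add_lt (by rwa [norm_neg]) (hct.trans_lt hc), hc⟩
    rw [norm_mul, mul_comm]
    exact mul_lt_mul_of_pos_right hs hw0

lemma lt_mul_norm_iff_of_large (h : 1 < ‖s‖ * ‖u‖) :
    ‖c‖ < ‖u‖ * ‖c * s - u‖ ↔ 1 < ‖c * s - u‖ * ‖s‖ := by
  have hs : 0 < ‖s‖ := by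
    refine (norm_nonneg s).lt_of_ne fun h' => ?_
    rw [← h', zero_mul] at h; linarith
  have hu : 0 < ‖u‖ := by
    refine (norm_nonneg u).lt_of_ne fun h' => ?_
    rw [← h', mul_zero] at h; linarith
  generalize hw : c * s - u = w
  have e : ‖c‖ * ‖s‖ = ‖u + w‖ := by rw [← norm_mul, ← hw]; congr 1; ring
  rw [← mul_lt_mul_iff_left₀ hs, e]
  constructor
  · intro h1
    by_contra! h2
    have h3 : ‖w‖ < ‖u‖ := by
      rw [← mul_lt_mul_iff_left₀ hs]; linarith
    rw [norm_add_eq_of_lt h3] at h1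
    nlinarith
  · intro h1
    refine norm_add_lt ?_ ?_ <;> nlinarith [norm_nonneg w]

lemma norm_mul_sub_eq_of_small (hu : u ≠ 0) (h : ‖s‖ * ‖u‖ ≤ 1) (hc : ‖c‖ < ‖u‖ ^ 2) :
    ‖c * s - u‖ = ‖u‖ := by
  have hu' := norm_pos_iff.2 hu
  have : ‖c * s‖ < ‖-u‖ := by
    rw [norm_mul, norm_neg]
    rcases (norm_nonneg s).eq_or_lt with hs | hs
    · rw [← hs, mul_zero]; exact hu'
    · calc ‖c‖ * ‖s‖ < ‖u‖ ^ 2 * ‖s‖ := mul_lt_mul_of_pos_right hc hs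
        _ = ‖u‖ * (‖s‖ * ‖u‖) := by ring
        _ ≤ ‖u‖ := mul_le_of_le_one_right hu'.le h
  rw [sub_eq_add_neg, add_comm, norm_add_eq_of_lt this, norm_neg]

lemma lt_mul_norm_iff_of_small (hu : u ≠ 0) (h : ‖s‖ * ‖u‖ ≤ 1) :
    ‖c‖ < ‖u‖ * ‖c * s - u‖ ↔ ‖c‖ < ‖u‖ ^ 2 := by
  have hu' := norm_pos_iff.2 hu
  constructor
  · intro h1
    rcases lt_or_ge ‖c * s‖ ‖u‖ with h2 | h2
    · rw [sub_eq_add_neg, add_comm, norm_add_eq_of_lt (by rwa [norm_neg]), norm_neg, ← sq] at h1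
      exact h1
    · have h3 : ‖c * s - u‖ ≤ ‖c‖ * ‖s‖ := by
        rw [sub_eq_add_neg, ← norm_mul]
        exact (Padic.nonarchimedean _ _).trans (max_le le_rfl (by rwa [norm_neg]))
      have h4 : ‖u‖ * ‖c * s - u‖ ≤ ‖c‖ := calc
        _ ≤ ‖u‖ * (‖c‖ * ‖s‖) := by gcongr
        _ = ‖c‖ * (‖s‖ * ‖u‖) := by ring
        _ ≤ ‖c‖ := mul_le_of_le_one_right (norm_nonneg _) h
      linarith
  · intro h1
    rw [norm_mul_sub_eq_of_small hu h h1, ← sq]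
    exact h1

end Algebra

lemma setOf_addValuation_eq :
    {q : ℚ_[p] × ℚ_[p] × ℚ_[p] × ℚ_[p] | Padic.addValuation (q.1 * q.2.2.1 - q.2.1 ^ 2) <
        min (Padic.addValuation q.1) (min (Padic.addValuation q.2.1) (Padic.addValuation q.2.2.1)) ∧
      Padic.addValuation (q.2.1 + q.2.2.1 * q.2.2.2) ≤ Padic.addValuation (q.1 + q.2.1 * q.2.2.2) ∧
      q.2.1 + q.2.2.1 * q.2.2.2 ≠ 0} =
    {q | ‖q.1 * q.2.2.1 - q.2.1 ^ 2‖ > max ‖q.1‖ (max ‖q.2.1‖ ‖q.2.2.1‖) ∧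
      ‖q.1 + q.2.1 * q.2.2.2‖ ≤ ‖q.2.1 + q.2.2.1 * q.2.2.2‖ ∧ q.2.1 + q.2.2.1 * q.2.2.2 ≠ 0} := by
  ext q
  simp only [Set.mem_ofPred_eq, lt_min_iff, addValuation_lt_iff, addValuation_le_iff, gt_iff_lt,
    max_lt_iff]

section Kernel

variable {θ : ℚ_[p] → ℂ}

open Classical in
/-- The integrand in the coordinates `u = b + c x`, `u (s - x) = a + b x`, apart from the factor
`θ (s - x)`, which is `1` on the region of integration. -/
noncomputable def kernel (θ : ℚ_[p] → ℂ) (ν₁ ν₂ : ℂ) (s u c : ℚ_[p]) : ℂ :=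
  if 1 < ‖u‖ ∧ ‖s‖ < ‖u‖ ∧ ‖c‖ < ‖u‖ * ‖c * s - u‖ then
    (‖u‖ : ℂ) ^ (-1 - ν₁) * (‖c * s - u‖ : ℂ) ^ (-1 - ν₂) * θ (-s - c) else 0

lemma enorm_kernel (hθ_unit : ∀ a : ℚ_[p], ‖θ a‖ = 1) (ν₁ ν₂ : ℂ) (s u c : ℚ_[p]) :
    ‖kernel θ ν₁ ν₂ s u c‖ₑ = if 1 < ‖u‖ ∧ ‖s‖ < ‖u‖ ∧ ‖c‖ < ‖u‖ * ‖c * s - u‖ then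
      ENNReal.ofReal (‖u‖ ^ (-1 - ν₁.re)) * ENNReal.ofReal (‖c * s - u‖ ^ (-1 - ν₂.re)) else 0 := by
  rw [kernel]
  split_ifs with h
  · have hu : 0 < ‖u‖ := one_pos.trans h.1
    have hw : 0 < ‖c * s - u‖ := by
      have := (norm_nonneg c).trans_lt h.2.2
      exact pos_of_mul_pos_right this hu.le
    rw [← ofReal_norm, norm_mul, norm_mul, hθ_unit, mul_one,
      Complex.norm_cpow_eq_rpow_re_of_pos hu, Complex.norm_cpow_eq_rpow_re_of_pos hw,
      ENNReal.ofReal_mul (by positivity)]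
    simp
  · simp

lemma norm_mul_integrand_change (hθ_add : ∀ a b : ℚ_[p], θ (a + b) = θ a * θ b)
    (hθ_triv : ∀ a : ℚ_[p], ‖a‖ ≤ 1 → θ a = 1) (ν₁ ν₂ : ℂ) (s u c x : ℚ_[p]) :
    (‖u‖ : ℂ) * ({q : ℚ_[p] × ℚ_[p] × ℚ_[p] × ℚ_[p] |
        ‖q.1 * q.2.2.1 - q.2.1 ^ 2‖ > max ‖q.1‖ (max ‖q.2.1‖ ‖q.2.2.1‖) ∧
        ‖q.1 + q.2.1 * q.2.2.2‖ ≤ ‖q.2.1 + q.2.2.1 * q.2.2.2‖ ∧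
        q.2.1 + q.2.2.1 * q.2.2.2 ≠ 0}).indicator
      (fun q => (‖q.2.1 + q.2.2.1 * q.2.2.2‖ : ℂ) ^ (-1 - ν₁ + ν₂) *
        (‖q.1 * q.2.2.1 - q.2.1 ^ 2‖ : ℂ) ^ (-1 - ν₂) * θ (-q.2.2.2 - q.2.2.1))
      (u * (s - 2 * x) + c * x ^ 2, u - c * x, c, x) =
    if ‖s - x‖ ≤ 1 then kernel θ ν₁ ν₂ s u c else 0 := by
  classical
  have e1 : u - c * x + c * x = u := by ring
  have e2 : u * (s - 2 * x) + c * x ^ 2 + (u - c * x) * x = u * (s - x) := by ring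
  have e3 : (u * (s - 2 * x) + c * x ^ 2) * c - (u - c * x) ^ 2 = u * (c * s - u) := by ring
  rcases eq_or_ne u 0 with rfl | hu
  · simp [kernel, show ¬ (1 : ℝ) < 0 by norm_num]
  have huC : (‖u‖ : ℂ) ≠ 0 := mod_cast (norm_pos_iff.2 hu).ne'
  have e5 : (‖u‖ : ℂ) ^ (-1 - ν₁) =
      ‖u‖ * (‖u‖ : ℂ) ^ (-1 - ν₁ + ν₂) * (‖u‖ : ℂ) ^ (-1 - ν₂) := by
    calc (‖u‖ : ℂ) ^ (-1 - ν₁) = (‖u‖ : ℂ) ^ (1 + (-1 - ν₁ + ν₂) + (-1 - ν₂)) := by congr 1; ring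
      _ = _ := by rw [Complex.cpow_add _ _ huC, Complex.cpow_add _ _ huC, Complex.cpow_one]
  simp only [Set.indicator_apply, Set.mem_ofPred_eq, e1, e2, e3, ne_eq, hu, not_false_eq_true,
    and_true, region_iff hu, ite_and, kernel]
  split_ifs with ht
  · have e4 : -x - c = (s - x) + (-s - c) := by ring
    rw [e4, hθ_add, hθ_triv _ ht, norm_mul, Complex.ofReal_mul,
      Complex.mul_cpow_ofReal_nonneg (norm_nonneg _) (norm_nonneg _), e5]
    ring
  all_goals simp

end Kernel

instance : SecondCountableTopology ℚ_[p] := secondCountable_of_proper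

variable [MeasurableSpace ℚ_[p]] [BorelSpace ℚ_[p]] {μ : Measure ℚ_[p]}

lemma isAddHaarMeasure (hμ_inv : ∀ a : ℚ_[p], μ.map (a + ·) = μ)
    (hμ_norm : μ {x : ℚ_[p] | ‖x‖ ≤ 1} = 1) : μ.IsAddHaarMeasure := by
  have : μ.IsAddLeftInvariant := ⟨hμ_inv⟩
  have hK : {x : ℚ_[p] | ‖x‖ ≤ 1} = Metric.closedBall 0 1 := by ext; simp
  refine Measure.isAddHaarMeasure_of_isCompact_nonempty_interior μ {x : ℚ_[p] | ‖x‖ ≤ 1} ?_ ?_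
    (by simp [hμ_norm]) (by simp [hμ_norm])
  · rw [hK]; exact isCompact_closedBall 0 1
  · rw [hK]
    exact ⟨0, Metric.ball_subset_interior_closedBall (Metric.mem_ball_self one_pos)⟩

variable [μ.IsAddHaarMeasure]

lemma measurableSet_ball (r : ℝ) : MeasurableSet {x : ℚ_[p] | ‖x‖ ≤ r} :=
  measurableSet_le (by fun_prop) (by fun_prop)

lemma measure_inv_ball (hμ : μ {x : ℚ_[p] | ‖x‖ ≤ 1} = 1) :
    μ {x : ℚ_[p] | ‖x‖ ≤ (p : ℝ)⁻¹} = (p : ℝ≥0∞)⁻¹ := by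
  have h1 := one_lt_cast (p := p)
  have hU : {x : ℚ_[p] | ‖x‖ ≤ 1} =
      ⋃ n : Fin p, (fun x => (-(n : ℕ) : ℚ_[p]) + x) ⁻¹' {x : ℚ_[p] | ‖x‖ ≤ (p : ℝ)⁻¹} := by
    ext x
    simp only [Set.mem_ofPred_eq, Set.mem_iUnion, Set.mem_preimage]
    constructor
    · intro hx
      obtain ⟨y, rfl⟩ : ∃ y : ℤ_[p], (y : ℚ_[p]) = x := ⟨⟨x, hx⟩, rfl⟩
      obtain ⟨n, hn, hm⟩ := PadicInt.exists_mem_range y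
      refine ⟨⟨n, hn⟩, norm_le_inv_of_lt_one ?_⟩
      rw [IsLocalRing.mem_maximalIdeal, PadicInt.mem_nonunits] at hm
      rw [PadicInt.norm_def, PadicInt.coe_sub, PadicInt.coe_natCast, ← neg_add_eq_sub] at hm
      exact hm
    · rintro ⟨n, hn⟩
      have : x = (n : ℕ) + (-(n : ℕ) + x) := by ring
      rw [this]
      refine (Padic.nonarchimedean _ _).trans
        (max_le ?_ (hn.trans (inv_le_one_of_one_le₀ h1.le)))
      simpa using Padic.norm_int_le_one (p := p) (n : ℕ)
  have hd : Pairwise (Function.onFun Disjoint fun n : Fin p =>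
      (fun x => (-(n : ℕ) : ℚ_[p]) + x) ⁻¹' {x : ℚ_[p] | ‖x‖ ≤ (p : ℝ)⁻¹}) := by
    intro m n hmn
    refine Set.disjoint_left.2 fun x hm hn => hmn ?_
    simp only [Set.mem_ofPred_eq, Set.mem_preimage] at hm hn
    have h2 : ‖((m - n : ℤ) : ℚ_[p])‖ < 1 := by
      have : ((m - n : ℤ) : ℚ_[p]) = (-(n : ℕ) + x) - (-(m : ℕ) + x) := by push_cast; ring
      rw [this, sub_eq_add_neg]
      refine ((Padic.nonarchimedean _ _).trans (max_le hn ?_)).trans_lt (inv_lt_one_of_one_lt₀ h1)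
      rwa [norm_neg]
    rw [Padic.norm_intCast_lt_one_iff] at h2
    have h3 := Int.eq_zero_of_abs_lt_dvd h2 (by have := m.2; have := n.2; rw [abs_lt]; omega)
    exact Fin.ext (by omega)
  rw [hU, measure_iUnion hd fun n => (measurable_const_add _) (measurableSet_ball _)] at hμ
  simp only [measure_preimage_add, tsum_fintype, Finset.sum_const, Finset.card_univ,
    Fintype.card_fin, nsmul_eq_mul] at hμ
  exact ENNReal.eq_inv_of_mul_eq_one_left (by rwa [mul_comm])

lemma distribHaarChar_eq (hμ : μ {x : ℚ_[p] | ‖x‖ ≤ 1} = 1) (u : ℚ_[p]ˣ) :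
    distribHaarChar ℚ_[p] u = ‖(u : ℚ_[p])‖₊ := by
  have hunit : ∀ u : ℚ_[p]ˣ, ‖(u : ℚ_[p])‖ = 1 → distribHaarChar ℚ_[p] u = 1 := by
    intro u hu
    refine distribHaarChar_eq_of_measure_smul_eq_mul (μ := μ) (s := {x : ℚ_[p] | ‖x‖ ≤ 1})
      (by simp [hμ]) (by simp [hμ]) ?_
    have : u • {x : ℚ_[p] | ‖x‖ ≤ 1} = {x : ℚ_[p] | ‖x‖ ≤ 1} := by
      ext x
      rw [mem_units_smul_set]
      simp [hu]
    simp [this]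
  have hp0 : (p : ℚ_[p]) ≠ 0 := mod_cast hp.out.ne_zero
  have hpos := cast_pos (p := p)
  have hpp : distribHaarChar ℚ_[p] (Units.mk0 (p : ℚ_[p]) hp0) = ‖(p : ℚ_[p])‖₊ := by
    refine distribHaarChar_eq_of_measure_smul_eq_mul (μ := μ) (s := {x : ℚ_[p] | ‖x‖ ≤ 1})
      (by simp [hμ]) (by simp [hμ]) ?_
    have : Units.mk0 (p : ℚ_[p]) hp0 • {x : ℚ_[p] | ‖x‖ ≤ 1} =
        {x : ℚ_[p] | ‖x‖ ≤ (p : ℝ)⁻¹} := by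
      ext x
      rw [mem_units_smul_set]
      simp only [Units.val_mk0, Set.mem_ofPred_eq, norm_mul, norm_inv, Padic.norm_p, inv_inv]
      rw [← one_div, le_div_iff₀' hpos]
    rw [this, measure_inv_ball hμ, hμ, mul_one]
    have h2 : ‖(p : ℚ_[p])‖₊ = (p : ℝ≥0)⁻¹ := by ext; simp
    rw [h2, ENNReal.coe_inv (mod_cast hp.out.ne_zero), ENNReal.coe_natCast]
  have hu0 : (u : ℚ_[p]) ≠ 0 := u.ne_zero
  set n := (u : ℚ_[p]).valuation with hn
  have hu : u = Units.mk0 (p : ℚ_[p]) hp0 ^ n * ((Units.mk0 (p : ℚ_[p]) hp0 ^ n)⁻¹ * u) := by simp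
  have hnu := Padic.norm_eq_zpow_neg_valuation hu0
  have h2 : ‖(((Units.mk0 (p : ℚ_[p]) hp0 ^ n)⁻¹ * u : ℚ_[p]ˣ) : ℚ_[p])‖ = 1 := by
    simp only [Units.val_mul, Units.val_inv_eq_inv_val, Units.val_zpow_eq_zpow_val, Units.val_mk0,
      norm_mul, norm_inv, norm_zpow, Padic.norm_p, hnu, ← hn, inv_zpow, inv_inv]
    rw [← zpow_add₀ hpos.ne', add_neg_cancel, zpow_zero]
  have h3 : ‖(u : ℚ_[p])‖₊ = ‖(p : ℚ_[p])‖₊ ^ n := by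
    ext
    simp only [coe_nnnorm, NNReal.coe_zpow, Padic.norm_p, hnu, ← hn, inv_zpow, zpow_neg]
  rw [h3, hu, map_mul, hunit _ h2, map_zpow, hpp, mul_one]

lemma map_mul_add (hμ : μ {x : ℚ_[p] | ‖x‖ ≤ 1} = 1) {u : ℚ_[p]} (hu : u ≠ 0) (v : ℚ_[p]) :
    ‖u‖₊ • μ.map (fun s => u * s + v) = μ := by
  have hm : Measurable fun s : ℚ_[p] => u * s + v := by fun_prop
  ext A hA
  rw [Measure.smul_apply, Measure.map_apply hm hA]
  have h := distribHaarChar_mul μ (Units.mk0 u hu) ((fun s => u * s + v) ⁻¹' A)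
  rw [distribHaarChar_eq hμ] at h
  have h2 : (Units.mk0 u hu) • ((fun s => u * s + v) ⁻¹' A) = (fun s => s + v) ⁻¹' A := by
    ext x
    rw [mem_units_smul_set]
    simp [hu]
  rw [h2, measure_preimage_add_right] at h
  rw [← h]
  rfl

lemma lintegral_affine (hμ : μ {x : ℚ_[p] | ‖x‖ ≤ 1} = 1) {u : ℚ_[p]} (hu : u ≠ 0) (v : ℚ_[p])
    {F : ℚ_[p] → ℝ≥0∞} (hF : Measurable F) :
    ∫⁻ a, F a ∂μ = ∫⁻ s, ‖u‖ₑ * F (u * s + v) ∂μ := by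
  conv_lhs => rw [← map_mul_add hμ hu v]
  have hm : Measurable fun s : ℚ_[p] => u * s + v := by fun_prop
  rw [lintegral_smul_measure, lintegral_map hF hm, lintegral_const_mul _ (by fun_prop)]
  rfl

lemma integral_mul_left (hμ : μ {x : ℚ_[p] | ‖x‖ ≤ 1} = 1) {u : ℚ_[p]} (hu : u ≠ 0)
    (F : ℚ_[p] → ℂ) :
    ∫ a, F a ∂μ = (‖u‖ : ℂ) * ∫ s, F (u * s) ∂μ := by
  conv_lhs => rw [← map_mul_add hμ hu 0]
  rw [integral_smul_nnreal_measure]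
  simp only [add_zero]
  have := (MeasurableEquiv.mulLeft₀ u hu).measurableEmbedding.integral_map (μ := μ) F
  simp only [MeasurableEquiv.coe_mulLeft₀] at this
  rw [this, NNReal.smul_def, Complex.real_smul, coe_nnnorm]

lemma measureReal_ball (hμ : μ {x : ℚ_[p] | ‖x‖ ≤ 1} = 1) {u : ℚ_[p]} (hu : u ≠ 0) :
    μ.real {x : ℚ_[p] | ‖x‖ ≤ ‖u‖} = ‖u‖ := by
  have h := lintegral_affine hμ hu 0
    (F := ({x : ℚ_[p] | ‖x‖ ≤ ‖u‖}).indicator 1) (measurable_one.indicator (measurableSet_ball _))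
  have h2 : ∀ s, ({x : ℚ_[p] | ‖x‖ ≤ ‖u‖}).indicator (1 : ℚ_[p] → ℝ≥0∞) (u * s + 0) =
      ({x : ℚ_[p] | ‖x‖ ≤ 1}).indicator (1 : ℚ_[p] → ℝ≥0∞) s := by
    intro s
    have h3 := norm_pos_iff.2 hu
    simp only [Set.indicator_apply, Set.mem_ofPred_eq, add_zero, norm_mul,
      mul_le_iff_le_one_right h3, Pi.one_apply]
  simp only [h2] at h
  rw [lintegral_const_mul _ (measurable_one.indicator (measurableSet_ball _)),
    lintegral_indicator_one (measurableSet_ball _), lintegral_indicator_one (measurableSet_ball _),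
    hμ, mul_one] at h
  rw [Measure.real, h, toReal_enorm]

lemma measure_ball (hμ : μ {x : ℚ_[p] | ‖x‖ ≤ 1} = 1) {u : ℚ_[p]} (hu : u ≠ 0) :
    μ {x : ℚ_[p] | ‖x‖ ≤ ‖u‖} = ENNReal.ofReal ‖u‖ := by
  have h := measureReal_ball hμ hu
  refine (ENNReal.ofReal_toReal fun h' => ?_).symm.trans (congrArg _ h)
  rw [Measure.real, h'] at h
  exact (norm_pos_iff.2 hu).ne h

lemma integrable_ball (hμ : μ {x : ℚ_[p] | ‖x‖ ≤ 1} = 1) {u : ℚ_[p]} (hu : u ≠ 0) :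
    Integrable (({x : ℚ_[p] | ‖x‖ ≤ ‖u‖}).indicator (1 : ℚ_[p] → ℂ)) μ := by
  rw [integrable_indicator_iff (measurableSet_ball _)]
  refine integrableOn_const ?_
  rw [measure_ball hμ hu]
  exact ENNReal.ofReal_ne_top

lemma integral_ball (hμ : μ {x : ℚ_[p] | ‖x‖ ≤ 1} = 1) {u : ℚ_[p]} (hu : u ≠ 0) :
    ∫ z, ({x : ℚ_[p] | ‖x‖ ≤ ‖u‖}).indicator (1 : ℚ_[p] → ℂ) z ∂μ = ‖u‖ := by
  rw [integral_indicator (measurableSet_ball _)]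
  simp [measureReal_ball hμ hu]

section Character

variable {θ : ℚ_[p] → ℂ}

lemma integral_mul_char_eq_zero (hθ_add : ∀ a b : ℚ_[p], θ (a + b) = θ a * θ b)
    (hθ_triv : ∀ a : ℚ_[p], ‖a‖ ≤ 1 → θ a = 1)
    (hθ_nontriv : ∃ a : ℚ_[p], ‖a‖ ≤ (p : ℝ) ∧ θ a ≠ 1)
    {g : ℚ_[p] → ℂ} (hg : ∀ a z, ‖a‖ ≤ (p : ℝ) → g (z + a) = g z) :
    ∫ z, g z * θ (-z) ∂μ = 0 := by
  obtain ⟨a, ha, hθa⟩ := hθ_nontriv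
  have h0 : θ (-a) * θ a = 1 := by rw [← hθ_add]; exact hθ_triv _ (by simp)
  have h1 : ∫ z, g z * θ (-z) ∂μ = θ (-a) * ∫ z, g z * θ (-z) ∂μ := by
    conv_lhs => rw [← integral_add_right_eq_self _ a]
    rw [← integral_const_mul]
    congr 1 with z
    rw [hg a z ha, neg_add, hθ_add]
    ring
  by_contra h2
  have h3 : θ (-a) = 1 := by
    have := mul_right_cancel₀ h2 (a := 1) (c := θ (-a)) (by rw [one_mul]; exact h1)
    exact this.symm
  rw [h3, one_mul] at h0
  exact hθa h0

lemma integral_radial_mul_char_eq_zero (hθ_add : ∀ a b : ℚ_[p], θ (a + b) = θ a * θ b)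
    (hθ_triv : ∀ a : ℚ_[p], ‖a‖ ≤ 1 → θ a = 1)
    (hθ_nontriv : ∃ a : ℚ_[p], ‖a‖ ≤ (p : ℝ) ∧ θ a ≠ 1)
    {g : ℝ → ℂ} (hg : ∀ r ≤ (p : ℝ), g r = 0) :
    ∫ z, g ‖z‖ * θ (-z) ∂μ = 0 := by
  refine integral_mul_char_eq_zero (g := fun z => g ‖z‖) hθ_add hθ_triv hθ_nontriv ?_
  intro a z ha
  rcases le_or_gt ‖z‖ p with hz | hz
  · simp only [hg _ hz, hg _ ((Padic.nonarchimedean z a).trans (max_le hz ha))]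
  · simp only [norm_add_eq_of_lt (ha.trans_lt hz)]

lemma integral_radial_mul_char (hμ : μ {x : ℚ_[p] | ‖x‖ ≤ 1} = 1) (hθ_cont : Continuous θ)
    (hθ_unit : ∀ a : ℚ_[p], ‖θ a‖ = 1)
    (hθ_add : ∀ a b : ℚ_[p], θ (a + b) = θ a * θ b)
    (hθ_triv : ∀ a : ℚ_[p], ‖a‖ ≤ 1 → θ a = 1)
    (hθ_nontriv : ∃ a : ℚ_[p], ‖a‖ ≤ (p : ℝ) ∧ θ a ≠ 1)
    {g : ℝ → ℂ} (hg : ∀ r ≤ ((p : ℝ) ^ 2)⁻¹, g r = 0)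
    (hint : Integrable (fun z => g ‖z‖ * θ (-z)) μ) :
    ∫ z, g ‖z‖ * θ (-z) ∂μ =
      (1 - (p : ℂ)⁻¹) * (p : ℂ)⁻¹ * g (p : ℝ)⁻¹ + (1 - (p : ℂ)⁻¹) * g 1 - g p := by
  have h1 := one_lt_cast (p := p)
  have hpos := cast_pos (p := p)
  have hp0 : (p : ℚ_[p]) ≠ 0 := mod_cast hp.out.ne_zero
  have h_inv : (p : ℝ)⁻¹ < 1 := inv_lt_one_of_one_lt₀ h1
  have h_inv2 : ((p : ℝ) ^ 2)⁻¹ < (p : ℝ)⁻¹ := by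
    rw [inv_lt_inv₀ (by positivity) hpos]; nlinarith
  set B : ℝ → ℚ_[p] → ℂ := fun r => ({x : ℚ_[p] | ‖x‖ ≤ r}).indicator 1 with hB
  have hBi : ∀ n : ℤ, Integrable (B ((p : ℝ) ^ n)) μ := by
    intro n
    have := integrable_ball hμ (zpow_ne_zero (-n) hp0)
    simpa using this
  have hBI : ∀ n : ℤ, ∫ z, B ((p : ℝ) ^ n) z ∂μ = (p : ℂ) ^ n := by
    intro n
    have := integral_ball hμ (zpow_ne_zero (-n) hp0)
    simpa using this
  have i1 : Integrable (B p) μ := by simpa using hBi 1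
  have i0 : Integrable (B 1) μ := by simpa using hBi 0
  have i_inv : Integrable (B (p : ℝ)⁻¹) μ := by simpa using hBi (-1)
  have i_inv2 : Integrable (B ((p : ℝ) ^ 2)⁻¹) μ := by simpa using hBi (-2)
  have j0 : ∫ z, B 1 z ∂μ = 1 := by simpa using hBI 0
  have j_inv : ∫ z, B (p : ℝ)⁻¹ z ∂μ = (p : ℂ)⁻¹ := by simpa using hBI (-1)
  have j_inv2 : ∫ z, B ((p : ℝ) ^ 2)⁻¹ z ∂μ = ((p : ℂ) ^ 2)⁻¹ := by simpa using hBI (-2)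
  set g' : ℝ → ℂ := fun r => if r ≤ p then 0 else g r with hg'
  have k1 : ∫ z, g' ‖z‖ * θ (-z) ∂μ = 0 :=
    integral_radial_mul_char_eq_zero hθ_add hθ_triv hθ_nontriv (fun r hr => by simp [hg', hr])
  have k2 : ∫ z, B p z * θ (-z) ∂μ = 0 := by
    refine integral_mul_char_eq_zero hθ_add hθ_triv hθ_nontriv ?_
    intro a z ha
    have : ‖z + a‖ ≤ p ↔ ‖z‖ ≤ p := by
      constructor
      · intro h
        have : z = (z + a) + (-a) := by ring
        rw [this]
        exact (Padic.nonarchimedean _ _).trans (max_le h (by rwa [norm_neg]))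
      · intro h
        exact (Padic.nonarchimedean _ _).trans (max_le h ha)
    simp only [hB, Set.indicator_apply, Set.mem_ofPred_eq, this, Pi.one_apply]
  have m1 : Integrable (fun z => B p z * θ (-z)) μ := by
    exact i1.mul_bdd (c := 1) (by fun_prop) (.of_forall fun z => (hθ_unit _).le)
  have m2 : Integrable (fun z => g' ‖z‖ * θ (-z)) μ := by
    have : (fun z => g' ‖z‖ * θ (-z)) =
        ({x : ℚ_[p] | ‖x‖ ≤ p}ᶜ).indicator (fun z => g ‖z‖ * θ (-z)) := by
      ext z
      by_cases hz : ‖z‖ ≤ p <;> simp [hg', hz]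
    rw [this]
    exact hint.indicator (measurableSet_ball _).compl
  have key : ∀ z, g ‖z‖ * θ (-z) = g' ‖z‖ * θ (-z) + g p * (B p z * θ (-z) - B 1 z) +
      g 1 * (B 1 z - B (p : ℝ)⁻¹ z) + g (p : ℝ)⁻¹ * (B (p : ℝ)⁻¹ z - B ((p : ℝ) ^ 2)⁻¹ z) := by
    intro z
    have hz1 : ‖z‖ ≤ 1 → θ (-z) = 1 := fun h => hθ_triv _ (by rwa [norm_neg])
    simp only [hg', hB, Set.indicator_apply, Set.mem_ofPred_eq, Pi.one_apply]
    rcases norm_cases z with h | h | h | h | h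
    · rw [if_neg (by linarith), if_neg (by linarith), if_neg (by linarith), if_neg (by linarith),
        if_neg (by linarith)]
      ring
    · rw [if_pos (by linarith), if_pos (by linarith), if_neg (by linarith), if_neg (by linarith),
        if_neg (by linarith), h]
      ring
    · rw [if_pos (by linarith), if_pos (by linarith), if_pos (by linarith), if_neg (by linarith),
        if_neg (by linarith), hz1 h.le, h]
      ring
    · rw [if_pos (by linarith), if_pos (by linarith), if_pos (by linarith), if_pos (by linarith),
        if_neg (by linarith), hz1 (by linarith), h]
      ring
    · rw [if_pos (by linarith), if_pos (by linarith), if_pos (by linarith), if_pos (by linarith),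
        if_pos (by linarith), hz1 (by linarith), hg _ h]
      ring
  simp only [key]
  rw [integral_add (by fun_prop) (by fun_prop), integral_add (by fun_prop) (by fun_prop),
    integral_add (by fun_prop) (by fun_prop), integral_const_mul, integral_const_mul,
    integral_const_mul, integral_sub (by fun_prop) (by fun_prop),
    integral_sub (by fun_prop) (by fun_prop), integral_sub (by fun_prop) (by fun_prop),
    k1, k2, j0, j_inv, j_inv2]
  ring

end Character

/-- The total mass of `‖z‖ ^ (-1 - σ)` outside the unit ball. -/
noncomputable def tailMass (μ : Measure ℚ_[p]) (σ : ℝ) : ℝ≥0∞ :=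
  ∫⁻ z, (if 1 < ‖z‖ then ENNReal.ofReal (‖z‖ ^ (-1 - σ)) else 0) ∂μ

lemma tailMass_lt_top (hμ : μ {x : ℚ_[p] | ‖x‖ ≤ 1} = 1) {σ : ℝ} (hσ : 0 < σ) :
    tailMass μ σ < ∞ := by
  have h1 := one_lt_cast (p := p)
  have hpos := cast_pos (p := p)
  have hp0 : (p : ℚ_[p]) ≠ 0 := mod_cast hp.out.ne_zero
  set b : ℕ → ℚ_[p] → ℝ≥0∞ := fun n => ({x : ℚ_[p] | ‖x‖ ≤ (p : ℝ) ^ n}).indicator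
    (fun _ => ENNReal.ofReal (((p : ℝ) ^ n) ^ (-1 - σ))) with hb
  have hle : ∀ z : ℚ_[p], (if 1 < ‖z‖ then ENNReal.ofReal (‖z‖ ^ (-1 - σ)) else 0) ≤
      ∑' n, b n z := by
    intro z
    split_ifs with hz
    · have hz0 : z ≠ 0 := by rintro rfl; simp at hz; linarith
      have hn := Padic.norm_eq_zpow_neg_valuation hz0
      have : 0 < -z.valuation := by
        rw [hn] at hz
        exact (one_lt_zpow_iff_right₀ h1).1 hz
      obtain ⟨n, hn2⟩ := Int.eq_ofNat_of_zero_le this.le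
      rw [hn2, zpow_natCast] at hn
      refine le_trans ?_ (ENNReal.le_tsum n)
      simp [hb, hn]
    · exact zero_le
  refine (lintegral_mono hle).trans_lt ?_
  rw [lintegral_tsum fun n => (measurable_const.indicator (measurableSet_ball _)).aemeasurable]
  have hbn : ∀ n, ∫⁻ z, b n z ∂μ = ENNReal.ofReal (((p : ℝ) ^ (-σ)) ^ n) := by
    intro n
    have h3 := measure_ball hμ (zpow_ne_zero (-n : ℤ) hp0)
    simp only [zpow_neg, zpow_natCast, norm_inv, norm_pow, Padic.norm_p, inv_pow, inv_inv] at h3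
    rw [hb, lintegral_indicator_const (measurableSet_ball _), h3,
      ← ENNReal.ofReal_mul (by positivity)]
    congr 1
    rw [sub_eq_add_neg, Real.rpow_add (by positivity), Real.rpow_neg_one,
      mul_right_comm, inv_mul_cancel₀ (by positivity), one_mul, ← Real.rpow_natCast,
      ← Real.rpow_mul hpos.le, ← Real.rpow_natCast, ← Real.rpow_mul hpos.le, mul_comm]
  rw [tsum_congr hbn]
  rw [← ENNReal.ofReal_tsum_of_nonneg (fun n => by positivity)]
  · exact ENNReal.ofReal_lt_top
  · exact summable_geometric_of_lt_one (by positivity)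
      (Real.rpow_lt_one_of_one_lt_of_neg h1 (by linarith))

lemma lintegral_tail (hμ : μ {x : ℚ_[p] | ‖x‖ ≤ 1} = 1) (σ : ℝ) {s : ℚ_[p]} (hs : s ≠ 0) :
    ∫⁻ z, (if 1 < ‖z‖ * ‖s‖ ^ 2 then ENNReal.ofReal (‖z‖ ^ (-1 - σ)) else 0) ∂μ =
      ENNReal.ofReal (‖s‖ ^ (2 * σ)) * tailMass μ σ := by
  have hs' := norm_pos_iff.2 hs
  have hs2 : (s ^ 2)⁻¹ ≠ 0 := by positivity
  have hM : Measurable fun z : ℚ_[p] => if 1 < ‖z‖ then ENNReal.ofReal (‖z‖ ^ (-1 - σ)) else 0 :=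
    Measurable.ite (measurableSet_lt (by fun_prop) (by fun_prop)) (by fun_prop) (by fun_prop)
  rw [lintegral_affine hμ hs2 0 (Measurable.ite (measurableSet_lt (by fun_prop) (by fun_prop))
    (by fun_prop) (by fun_prop)), tailMass, ← lintegral_const_mul _ hM]
  congr 1 with z
  have h1 : ‖(s ^ 2)⁻¹ * z + 0‖ = (‖s‖ ^ 2)⁻¹ * ‖z‖ := by simp
  rw [h1, mul_right_comm, inv_mul_cancel₀ (by positivity), one_mul]
  split_ifs with h
  · rw [← ofReal_norm, ← ENNReal.ofReal_mul (by positivity),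
      ← ENNReal.ofReal_mul (by positivity), Real.mul_rpow (by positivity) (by positivity),
      ← mul_assoc, norm_inv, norm_pow]
    congr 2
    rw [← Real.rpow_natCast, ← Real.rpow_neg hs'.le, ← Real.rpow_mul hs'.le, ← Real.rpow_add hs']
    congr 1
    push_cast
    ring
  · simp

lemma lintegral_change (hμ : μ {x : ℚ_[p] | ‖x‖ ≤ 1} = 1)
    {G : ℚ_[p] × ℚ_[p] × ℚ_[p] × ℚ_[p] → ℝ≥0∞} (hG : Measurable G)
    (h0 : ∀ a b c x, b + c * x = 0 → G (a, b, c, x) = 0) :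
    ∫⁻ q, G q ∂(μ.prod (μ.prod (μ.prod μ))) =
      ∫⁻ q, ‖q.2.1‖ₑ * G (q.2.1 * (q.1 - 2 * q.2.2.2) + q.2.2.1 * q.2.2.2 ^ 2,
        q.2.1 - q.2.2.1 * q.2.2.2, q.2.2) ∂(μ.prod (μ.prod (μ.prod μ))) := by
  have hG' : Measurable fun q : ℚ_[p] × ℚ_[p] × ℚ_[p] × ℚ_[p] =>
      ‖q.2.1‖ₑ * G (q.2.1 * (q.1 - 2 * q.2.2.2) + q.2.2.1 * q.2.2.2 ^ 2,
        q.2.1 - q.2.2.1 * q.2.2.2, q.2.2) := by fun_prop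
  rw [lintegral_prod_symm' _ hG, lintegral_prod_symm' _ hG.lintegral_prod_left',
    lintegral_prod_symm' _ hG', lintegral_prod_symm' _ hG'.lintegral_prod_left']
  congr 1 with ⟨c, x⟩
  simp only
  rw [← lintegral_sub_right_eq_self _ (c * x)]
  congr 1 with u
  rcases eq_or_ne u 0 with rfl | hu
  · simp [h0]
  · rw [lintegral_affine hμ hu (u * (-2 * x) + c * x ^ 2) (by fun_prop)]
    congr 1 with s
    congr 3
    ring

lemma map_withDensity_change (hμ : μ {x : ℚ_[p] | ‖x‖ ≤ 1} = 1) :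
    Measure.map (fun q : ℚ_[p] × ℚ_[p] × ℚ_[p] × ℚ_[p] =>
        (q.2.1 * (q.1 - 2 * q.2.2.2) + q.2.2.1 * q.2.2.2 ^ 2, q.2.1 - q.2.2.1 * q.2.2.2, q.2.2))
      ((μ.prod (μ.prod (μ.prod μ))).withDensity fun q => (‖q.2.1‖₊ : ℝ≥0∞)) =
    (μ.prod (μ.prod (μ.prod μ))).restrict {q | q.2.1 + q.2.2.1 * q.2.2.2 ≠ 0} := by
  have hE : MeasurableSet {q : ℚ_[p] × ℚ_[p] × ℚ_[p] × ℚ_[p] | q.2.1 + q.2.2.1 * q.2.2.2 ≠ 0} :=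
    (measurableSet_eq_fun (by fun_prop) (by fun_prop)).compl
  have hΨ : Measurable fun q : ℚ_[p] × ℚ_[p] × ℚ_[p] × ℚ_[p] =>
      (q.2.1 * (q.1 - 2 * q.2.2.2) + q.2.2.1 * q.2.2.2 ^ 2, q.2.1 - q.2.2.1 * q.2.2.2, q.2.2) := by
    fun_prop
  ext A hA
  classical
  rw [Measure.map_apply hΨ hA, withDensity_apply _ (hΨ hA), Measure.restrict_apply hA,
    ← lintegral_indicator_one (hA.inter hE),
    lintegral_change hμ (measurable_one.indicator (hA.inter hE)), ← lintegral_indicator (hΨ hA)]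
  · congr 1 with q
    rcases eq_or_ne q.2.1 0 with h | h
    · simp [h, Set.indicator_apply]
    · simp [h, Set.indicator_apply, Set.mem_preimage, enorm_eq_nnnorm]
  · intro a b c x h
    simp [h]

lemma measure_ball_sub (hμ : μ {x : ℚ_[p] | ‖x‖ ≤ 1} = 1) (s : ℚ_[p]) :
    μ {x : ℚ_[p] | ‖s - x‖ ≤ 1} = 1 := by
  have : {x : ℚ_[p] | ‖s - x‖ ≤ 1} = (fun x => x - s) ⁻¹' {x : ℚ_[p] | ‖x‖ ≤ 1} := by
    ext x
    rw [Set.mem_preimage, Set.mem_ofPred_eq, Set.mem_ofPred_eq, norm_sub_rev]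
  simp_rw [this, sub_eq_add_neg]
  rw [measure_preimage_add_right, hμ]

lemma measurableSet_and {α : Type*} [MeasurableSpace α] {P Q : α → Prop}
    (hP : MeasurableSet {a | P a}) (hQ : MeasurableSet {a | Q a}) :
    MeasurableSet {a | P a ∧ Q a} :=
  hP.inter hQ

variable {θ : ℚ_[p] → ℂ}

lemma measurable_kernel (hθ : Continuous θ) (ν₁ ν₂ : ℂ) :
    Measurable fun q : ℚ_[p] × ℚ_[p] × ℚ_[p] × ℚ_[p] => kernel θ ν₁ ν₂ q.1 q.2.1 q.2.2.1 := by
  have hθ' := hθ.measurable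
  have h1 : MeasurableSet {q : ℚ_[p] × ℚ_[p] × ℚ_[p] × ℚ_[p] | 1 < ‖q.2.1‖ ∧ ‖q.1‖ < ‖q.2.1‖ ∧
      ‖q.2.2.1‖ < ‖q.2.1‖ * ‖q.2.2.1 * q.1 - q.2.1‖} :=
    measurableSet_and (measurableSet_lt (by fun_prop) (by fun_prop))
      (measurableSet_and (measurableSet_lt (by fun_prop) (by fun_prop))
        (measurableSet_lt (by fun_prop) (by fun_prop)))
  exact Measurable.ite h1 (by fun_prop) measurable_const

lemma lintegral_enorm_kernel_le (hμ : μ {x : ℚ_[p] | ‖x‖ ≤ 1} = 1)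
    (hθ_unit : ∀ a : ℚ_[p], ‖θ a‖ = 1) {ν₁ ν₂ : ℂ} (hν₂ : 1 < ν₂.re) (s u : ℚ_[p]) :
    ∫⁻ c, ‖kernel θ ν₁ ν₂ s u c‖ₑ ∂μ ≤ if 1 < ‖u‖ ∧ ‖s‖ < ‖u‖ then
      (tailMass μ ν₂.re + 1) * ENNReal.ofReal (‖u‖ ^ (-2 - (ν₁ - ν₂).re)) else 0 := by
  simp_rw [enorm_kernel hθ_unit]
  split_ifs with h
  swap
  · simp only [← and_assoc, h, false_and, if_false, lintegral_zero, le_refl]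
  have hu : 0 < ‖u‖ := one_pos.trans h.1
  have hu0 := norm_pos_iff.1 hu
  have hexp : ENNReal.ofReal (‖u‖ ^ (-2 - (ν₁ - ν₂).re)) =
      ENNReal.ofReal (‖u‖ ^ (-1 - ν₁.re)) * ENNReal.ofReal (‖u‖ ^ (ν₂.re - 1)) := by
    rw [← ENNReal.ofReal_mul (by positivity), ← Real.rpow_add hu, Complex.sub_re]
    ring_nf
  simp only [h.1, h.2, true_and]
  simp_rw [← mul_ite_zero]
  rw [hexp, lintegral_const_mul _ (Measurable.ite
    (measurableSet_lt (by fun_prop) (by fun_prop)) (by fun_prop) (by fun_prop)), mul_left_comm]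
  gcongr
  rcases lt_or_ge 1 (‖s‖ * ‖u‖) with hsu | hsu
  · simp_rw [lt_mul_norm_iff_of_large hsu]
    have hs0 : s ≠ 0 := by rintro rfl; simp at hsu; linarith
    have hs := norm_pos_iff.2 hs0
    rw [← lintegral_add_right_eq_self _ (u / s)]
    have e : ∀ c, (c + u / s) * s - u = c * s := fun c => by field_simp; ring
    have e2 : ∀ c : ℚ_[p], (if 1 < ‖c * s‖ * ‖s‖ then
        ENNReal.ofReal (‖c * s‖ ^ (-1 - ν₂.re)) else 0) =
        ENNReal.ofReal (‖s‖ ^ (-1 - ν₂.re)) *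
          (if 1 < ‖c‖ * ‖s‖ ^ 2 then ENNReal.ofReal (‖c‖ ^ (-1 - ν₂.re)) else 0) := by
      intro c
      rw [norm_mul, mul_assoc, ← sq, mul_ite_zero, ← ENNReal.ofReal_mul (by positivity),
        Real.mul_rpow (norm_nonneg _) (norm_nonneg _), mul_comm (‖s‖ ^ (_ : ℝ))]
    simp_rw [e, e2]
    rw [lintegral_const_mul _ (Measurable.ite (measurableSet_lt (by fun_prop) (by fun_prop))
      (by fun_prop) (by fun_prop)), lintegral_tail hμ _ hs0, ← mul_assoc,
      ← ENNReal.ofReal_mul (by positivity), ← Real.rpow_add hs, mul_comm]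
    gcongr
    · exact le_self_add
    · rw [show -1 - ν₂.re + 2 * ν₂.re = ν₂.re - 1 by ring]
      exact Real.rpow_le_rpow hs.le h.2.le (by linarith)
  · calc _ ≤ ∫⁻ c, ({x : ℚ_[p] | ‖x‖ ≤ ‖u ^ 2‖}).indicator
          (fun _ => ENNReal.ofReal (‖u‖ ^ (-1 - ν₂.re))) c ∂μ := by
          refine lintegral_mono fun c => ?_
          simp only [lt_mul_norm_iff_of_small hu0 hsu]
          split_ifs with hc
          · rw [norm_mul_sub_eq_of_small hu0 hsu hc, Set.indicator_of_mem]
            rw [Set.mem_ofPred_eq, norm_pow]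
            exact hc.le
          · exact zero_le
      _ = ENNReal.ofReal (‖u‖ ^ (1 - ν₂.re)) := by
          rw [lintegral_indicator_const (measurableSet_ball _), measure_ball hμ (pow_ne_zero 2 hu0),
            ← ENNReal.ofReal_mul (by positivity), norm_pow, ← Real.rpow_natCast, ← Real.rpow_add hu]
          norm_num
          ring_nf
      _ ≤ 1 * ENNReal.ofReal (‖u‖ ^ (ν₂.re - 1)) := by
          rw [one_mul]
          exact ENNReal.ofReal_le_ofReal (Real.rpow_le_rpow_of_exponent_le h.1.le (by linarith))
      _ ≤ _ := by gcongr; exact le_add_self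

lemma integrable_kernel (hμ : μ {x : ℚ_[p] | ‖x‖ ≤ 1} = 1) (hθ_cont : Continuous θ)
    (hθ_unit : ∀ a : ℚ_[p], ‖θ a‖ = 1) {ν₁ ν₂ : ℂ} (hν₂ : 1 < ν₂.re) (hν : 1 < (ν₁ - ν₂).re) :
    Integrable (fun q : ℚ_[p] × ℚ_[p] × ℚ_[p] × ℚ_[p] =>
      if ‖q.1 - q.2.2.2‖ ≤ 1 then kernel θ ν₁ ν₂ q.1 q.2.1 q.2.2.1 else 0)
      (μ.prod (μ.prod (μ.prod μ))) := by
  have hM : Measurable (fun q : ℚ_[p] × ℚ_[p] × ℚ_[p] × ℚ_[p] =>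
      if ‖q.1 - q.2.2.2‖ ≤ 1 then kernel θ ν₁ ν₂ q.1 q.2.1 q.2.2.1 else 0) :=
    Measurable.ite (measurableSet_le (by fun_prop) (by fun_prop))
      (measurable_kernel hθ_cont ν₁ ν₂) measurable_const
  refine ⟨hM.aestronglyMeasurable, ?_⟩
  have hM' := hM.enorm
  rw [HasFiniteIntegral, lintegral_prod _ hM'.aemeasurable]
  have hx : ∀ s u c : ℚ_[p], ∫⁻ x, ‖if ‖s - x‖ ≤ 1 then kernel θ ν₁ ν₂ s u c else 0‖ₑ ∂μ =
      ‖kernel θ ν₁ ν₂ s u c‖ₑ := by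
    intro s u c
    have hS : MeasurableSet {x : ℚ_[p] | ‖s - x‖ ≤ 1} :=
      measurableSet_le (by fun_prop) (by fun_prop)
    rw [← mul_one ‖kernel θ ν₁ ν₂ s u c‖ₑ, ← measure_ball_sub hμ s,
      ← lintegral_indicator_const hS]
    congr 1 with x
    simp only [Set.indicator_apply, Set.mem_ofPred_eq]
    split_ifs <;> simp
  calc _ ≤ ∫⁻ s, ∫⁻ u, (if 1 < ‖u‖ ∧ ‖s‖ < ‖u‖ then
      (tailMass μ ν₂.re + 1) * ENNReal.ofReal (‖u‖ ^ (-2 - (ν₁ - ν₂).re)) else 0) ∂μ ∂μ := by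
        refine lintegral_mono fun s => ?_
        have hMs := hM'.comp (measurable_prodMk_left (x := s))
        simp only [Function.comp_def] at hMs ⊢
        rw [lintegral_prod _ hMs.aemeasurable]
        refine lintegral_mono fun u => ?_
        have hMu := hMs.comp (measurable_prodMk_left (x := u))
        simp only [Function.comp_def] at hMu ⊢
        rw [lintegral_prod _ hMu.aemeasurable]
        simp_rw [hx]
        exact lintegral_enorm_kernel_le hμ hθ_unit hν₂ s u
    _ = ∫⁻ u, ∫⁻ s, (if 1 < ‖u‖ ∧ ‖s‖ < ‖u‖ then
      (tailMass μ ν₂.re + 1) * ENNReal.ofReal (‖u‖ ^ (-2 - (ν₁ - ν₂).re)) else 0) ∂μ ∂μ := by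
        refine lintegral_lintegral_swap (Measurable.aemeasurable ?_)
        exact Measurable.ite (measurableSet_and (measurableSet_lt (by fun_prop) (by fun_prop))
          (measurableSet_lt (by fun_prop) (by fun_prop))) (by fun_prop) measurable_const
    _ ≤ ∫⁻ u, (tailMass μ ν₂.re + 1) *
        (if 1 < ‖u‖ then ENNReal.ofReal (‖u‖ ^ (-1 - (ν₁ - ν₂).re)) else 0) ∂μ := by
        refine lintegral_mono fun u => ?_
        simp only
        split_ifs with hu
        · have hu' : 0 < ‖u‖ := one_pos.trans hu
          calc _ ≤ ∫⁻ s, ({x : ℚ_[p] | ‖x‖ ≤ ‖u‖}).indicator (fun _ =>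
              (tailMass μ ν₂.re + 1) * ENNReal.ofReal (‖u‖ ^ (-2 - (ν₁ - ν₂).re))) s ∂μ := by
                refine lintegral_mono fun s => ?_
                simp only
                split_ifs with hs
                · rw [Set.indicator_of_mem (by exact hs.2.le)]
                · exact zero_le
            _ = _ := by
                rw [lintegral_indicator_const (measurableSet_ball _),
                  measure_ball hμ (norm_pos_iff.1 hu'), mul_assoc,
                  ← ENNReal.ofReal_mul (by positivity), ← Real.rpow_add_one hu'.ne']
                ring_nf
        · simp [hu]
    _ = (tailMass μ ν₂.re + 1) * tailMass μ (ν₁ - ν₂).re := by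
        rw [tailMass, tailMass, lintegral_const_mul _ (Measurable.ite
          (measurableSet_lt (by fun_prop) (by fun_prop)) (by fun_prop) (by fun_prop))]
    _ < ∞ := ENNReal.mul_lt_top
        (ENNReal.add_lt_top.2 ⟨tailMass_lt_top hμ (by linarith), ENNReal.one_lt_top⟩)
        (tailMass_lt_top hμ (by linarith))

open Classical in
/-- The integral of `|z|^(-1-ν) θ(-z)` over `1 < |z| r²`. -/
noncomputable def tailChar (μ : Measure ℚ_[p]) (θ : ℚ_[p] → ℂ) (ν : ℂ) (r : ℝ) : ℂ :=
  ∫ z, (if 1 < ‖z‖ * r ^ 2 then (‖z‖ : ℂ) ^ (-1 - ν) else 0) * θ (-z) ∂μ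

lemma tailChar_eq_zero (hθ_add : ∀ a b : ℚ_[p], θ (a + b) = θ a * θ b)
    (hθ_triv : ∀ a : ℚ_[p], ‖a‖ ≤ 1 → θ a = 1)
    (hθ_nontriv : ∃ a : ℚ_[p], ‖a‖ ≤ (p : ℝ) ∧ θ a ≠ 1) (ν : ℂ) {s : ℚ_[p]} (hs : ‖s‖ < 1) :
    tailChar μ θ ν ‖s‖ = 0 := by
  have hpos := cast_pos (p := p)
  refine integral_radial_mul_char_eq_zero hθ_add hθ_triv hθ_nontriv
    (g := fun r => if 1 < r * ‖s‖ ^ 2 then (r : ℂ) ^ (-1 - ν) else 0) fun r hr => if_neg ?_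
  have h1 : ‖s‖ ^ 2 ≤ (p : ℝ)⁻¹ := by
    nlinarith [norm_nonneg s, norm_le_inv_of_lt_one hs]
  rw [not_lt]
  calc r * ‖s‖ ^ 2 ≤ p * (p : ℝ)⁻¹ := by gcongr
    _ = 1 := mul_inv_cancel₀ hpos.ne'

lemma integrable_tail (hμ : μ {x : ℚ_[p] | ‖x‖ ≤ 1} = 1) (hθ_cont : Continuous θ)
    (hθ_unit : ∀ a : ℚ_[p], ‖θ a‖ = 1) {ν : ℂ} (hν : 0 < ν.re) {s : ℚ_[p]} (hs : s ≠ 0) :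
    Integrable (fun z : ℚ_[p] =>
      (if 1 < ‖z‖ * ‖s‖ ^ 2 then (‖z‖ : ℂ) ^ (-1 - ν) else 0) * θ (-z)) μ := by
  have hθ := hθ_cont.measurable
  refine ⟨((Measurable.ite (measurableSet_lt (by fun_prop) (by fun_prop)) (by fun_prop)
    measurable_const).mul (by fun_prop)).aestronglyMeasurable, ?_⟩
  have e : ∀ z : ℚ_[p], ‖(if 1 < ‖z‖ * ‖s‖ ^ 2 then (‖z‖ : ℂ) ^ (-1 - ν) else 0) * θ (-z)‖ₑ =
      if 1 < ‖z‖ * ‖s‖ ^ 2 then ENNReal.ofReal (‖z‖ ^ (-1 - ν.re)) else 0 := by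
    intro z
    split_ifs with h
    · have hz : 0 < ‖z‖ := pos_of_mul_pos_left (one_pos.trans h) (by positivity)
      rw [← ofReal_norm, norm_mul, hθ_unit, mul_one, Complex.norm_cpow_eq_rpow_re_of_pos hz]
      simp
    · simp
  rw [HasFiniteIntegral, lintegral_congr e, lintegral_tail hμ _ hs]
  exact ENNReal.mul_lt_top ENNReal.ofReal_lt_top (tailMass_lt_top hμ hν)

lemma tailChar_eq (hμ : μ {x : ℚ_[p] | ‖x‖ ≤ 1} = 1) (hθ_cont : Continuous θ)
    (hθ_unit : ∀ a : ℚ_[p], ‖θ a‖ = 1) (hθ_add : ∀ a b : ℚ_[p], θ (a + b) = θ a * θ b)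
    (hθ_triv : ∀ a : ℚ_[p], ‖a‖ ≤ 1 → θ a = 1)
    (hθ_nontriv : ∃ a : ℚ_[p], ‖a‖ ≤ (p : ℝ) ∧ θ a ≠ 1) {ν : ℂ} (hν : 0 < ν.re)
    {s : ℚ_[p]} (hs : s ≠ 0) (hsp : ‖s‖ ≤ p) :
    tailChar μ θ ν ‖s‖ =
      (1 - (p : ℂ)⁻¹) * (p : ℂ)⁻¹ *
          (if 1 < (p : ℝ)⁻¹ * ‖s‖ ^ 2 then (((p : ℝ)⁻¹ : ℝ) : ℂ) ^ (-1 - ν) else 0) +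
        (1 - (p : ℂ)⁻¹) * (if 1 < ‖s‖ ^ 2 then 1 else 0) -
        (if 1 < p * ‖s‖ ^ 2 then (p : ℂ) ^ (-1 - ν) else 0) := by
  have hpos := cast_pos (p := p)
  have := integral_radial_mul_char hμ hθ_cont hθ_unit hθ_add hθ_triv hθ_nontriv
    (g := fun r => if 1 < r * ‖s‖ ^ 2 then (r : ℂ) ^ (-1 - ν) else 0) (fun r hr => if_neg ?_)
    (integrable_tail hμ hθ_cont hθ_unit hν hs)
  · rw [tailChar, this]
    simp
  · rw [not_lt]
    calc r * ‖s‖ ^ 2 ≤ ((p : ℝ) ^ 2)⁻¹ * (p : ℝ) ^ 2 := by gcongr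
      _ = 1 := inv_mul_cancel₀ (by positivity)

lemma tailChar_one (hμ : μ {x : ℚ_[p] | ‖x‖ ≤ 1} = 1) (hθ_cont : Continuous θ)
    (hθ_unit : ∀ a : ℚ_[p], ‖θ a‖ = 1) (hθ_add : ∀ a b : ℚ_[p], θ (a + b) = θ a * θ b)
    (hθ_triv : ∀ a : ℚ_[p], ‖a‖ ≤ 1 → θ a = 1)
    (hθ_nontriv : ∃ a : ℚ_[p], ‖a‖ ≤ (p : ℝ) ∧ θ a ≠ 1) {ν : ℂ} (hν : 0 < ν.re) :
    tailChar μ θ ν 1 = -(p : ℂ) ^ (-1 - ν) := by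
  have h1 := one_lt_cast (p := p)
  have := tailChar_eq hμ hθ_cont hθ_unit hθ_add hθ_triv hθ_nontriv hν one_ne_zero
    (by simpa using h1.le)
  have h2 : ¬ 1 < (p : ℝ)⁻¹ := (inv_lt_one_of_one_lt₀ h1).not_gt
  rw [norm_one] at this
  rw [this]
  simp [h1, h2]

lemma tailChar_p (hμ : μ {x : ℚ_[p] | ‖x‖ ≤ 1} = 1) (hθ_cont : Continuous θ)
    (hθ_unit : ∀ a : ℚ_[p], ‖θ a‖ = 1) (hθ_add : ∀ a b : ℚ_[p], θ (a + b) = θ a * θ b)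
    (hθ_triv : ∀ a : ℚ_[p], ‖a‖ ≤ 1 → θ a = 1)
    (hθ_nontriv : ∃ a : ℚ_[p], ‖a‖ ≤ (p : ℝ) ∧ θ a ≠ 1) {ν : ℂ} (hν : 0 < ν.re) :
    tailChar μ θ ν p =
      (1 - (p : ℂ)⁻¹) * (p : ℂ) ^ ν + (1 - (p : ℂ)⁻¹) - (p : ℂ) ^ (-1 - ν) := by
  have h1 := one_lt_cast (p := p)
  have hpos := cast_pos (p := p)
  have hp0 : (p : ℂ) ≠ 0 := mod_cast hp.out.ne_zero
  have hs : (p : ℚ_[p])⁻¹ ≠ 0 := inv_ne_zero (mod_cast hp.out.ne_zero)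
  have hn : ‖(p : ℚ_[p])⁻¹‖ = p := by rw [norm_inv, Padic.norm_p, inv_inv]
  have := tailChar_eq hμ hθ_cont hθ_unit hθ_add hθ_triv hθ_nontriv hν hs hn.le
  rw [hn] at this
  have e1 : 1 < (p : ℝ)⁻¹ * (p : ℝ) ^ 2 := by
    rw [sq, inv_mul_cancel_left₀ hpos.ne']; exact h1
  have e2 : 1 < (p : ℝ) ^ 2 := one_lt_pow₀ h1 two_ne_zero
  have e3 : 1 < p * (p : ℝ) ^ 2 := by nlinarith
  have e4 : (((p : ℝ)⁻¹ : ℝ) : ℂ) ^ (-1 - ν) = p * (p : ℂ) ^ ν := by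
    rw [Complex.ofReal_inv, Complex.ofReal_natCast, Complex.inv_cpow _ _ (by
      rw [Complex.natCast_arg]; exact Real.pi_pos.ne), ← Complex.cpow_neg,
      show -(-1 - ν) = 1 + ν by ring, Complex.cpow_add _ _ hp0, Complex.cpow_one]
  rw [this, if_pos e1, if_pos e2, if_pos e3, e4, mul_one, mul_assoc, inv_mul_cancel_left₀ hp0]

lemma integral_kernel_third (hθ_add : ∀ a b : ℚ_[p], θ (a + b) = θ a * θ b)
    (hθ_triv : ∀ a : ℚ_[p], ‖a‖ ≤ 1 → θ a = 1)
    (hθ_nontriv : ∃ a : ℚ_[p], ‖a‖ ≤ (p : ℝ) ∧ θ a ≠ 1) (ν₁ ν₂ : ℂ) (s u : ℚ_[p]) :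
    ∫ c, kernel θ ν₁ ν₂ s u c ∂μ = if 1 ≤ ‖s‖ ∧ ‖s‖ < ‖u‖ then
      (‖s‖ : ℂ) ^ (-1 - ν₂) * θ (-s) * tailChar μ θ ν₂ ‖s‖ *
        ((‖u‖ : ℂ) ^ (-1 - ν₁) * θ (-(u / s))) else 0 := by
  have h1 := one_lt_cast (p := p)
  by_cases h : 1 < ‖u‖ ∧ ‖s‖ < ‖u‖
  swap
  · rw [if_neg fun h' => h ⟨h'.1.trans_lt h'.2, h'.2⟩]
    simp only [kernel, ← and_assoc, h, false_and, if_false, integral_zero]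
  have hu : 0 < ‖u‖ := one_pos.trans h.1
  have hu0 := norm_pos_iff.1 hu
  rcases lt_or_ge 1 (‖s‖ * ‖u‖) with hsu | hsu
  · have hs0 : s ≠ 0 := by rintro rfl; simp at hsu; linarith
    have e : ∫ c, kernel θ ν₁ ν₂ s u c ∂μ = (‖s‖ : ℂ) ^ (-1 - ν₂) * θ (-s) *
        tailChar μ θ ν₂ ‖s‖ * ((‖u‖ : ℂ) ^ (-1 - ν₁) * θ (-(u / s))) := by
      rw [← integral_add_right_eq_self _ (u / s), tailChar, mul_right_comm, ← integral_const_mul]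
      congr 1 with c
      have e1 : (c + u / s) * s - u = c * s := by field_simp; ring
      have e2 : -s - (c + u / s) = -s + (-(u / s) + -c) := by ring
      have e3 : ‖c + u / s‖ < ‖u‖ * ‖c * s‖ ↔ 1 < ‖c‖ * ‖s‖ ^ 2 := by
        rw [← e1, lt_mul_norm_iff_of_large hsu, e1, norm_mul, mul_assoc, ← sq]
      simp only [kernel, e3, e1, h.1, h.2, true_and]
      split_ifs
      · rw [norm_mul, e2, hθ_add, hθ_add, Complex.ofReal_mul,
          Complex.mul_cpow_ofReal_nonneg (norm_nonneg _) (norm_nonneg _)]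
        ring
      · simp
    rw [e]
    rcases lt_or_ge ‖s‖ 1 with hs | hs
    · rw [tailChar_eq_zero hθ_add hθ_triv hθ_nontriv ν₂ hs, if_neg fun h' => h'.1.not_gt hs]
      ring
    · rw [if_pos ⟨hs, h.2⟩]
  · have hs : ‖s‖ < 1 := by nlinarith [norm_nonneg s, h.1]
    rw [if_neg fun h' => h'.1.not_gt hs]
    have hpu : (p : ℝ) ≤ ‖u‖ := by
      by_contra! h'
      exact (norm_le_one_of_lt h').not_gt h.1
    have e : ∀ c, kernel θ ν₁ ν₂ s u c = (‖u‖ : ℂ) ^ (-1 - ν₁) * (‖u‖ : ℂ) ^ (-1 - ν₂) * θ (-s) *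
        ((if ‖c‖ < ‖u‖ ^ 2 then 1 else 0) * θ (-c)) := by
      intro c
      simp only [kernel, lt_mul_norm_iff_of_small hu0 hsu, h.1, h.2, true_and]
      split_ifs with hc
      · rw [norm_mul_sub_eq_of_small hu0 hsu hc, sub_eq_add_neg (-s), hθ_add]
        ring
      · simp
    simp_rw [e]
    rw [integral_const_mul, integral_mul_char_eq_zero hθ_add hθ_triv hθ_nontriv, mul_zero]
    intro a z ha
    have ha' : ‖a‖ < ‖u‖ ^ 2 := by nlinarith
    have : ‖z + a‖ < ‖u‖ ^ 2 ↔ ‖z‖ < ‖u‖ ^ 2 :=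
      ⟨fun hz => by simpa using norm_add_lt hz (by rwa [norm_neg] : ‖-a‖ < ‖u‖ ^ 2),
        fun hz => norm_add_lt hz ha'⟩
    simp only [this]

lemma integral_kernel_second (hμ : μ {x : ℚ_[p] | ‖x‖ ≤ 1} = 1)
    (hθ_add : ∀ a b : ℚ_[p], θ (a + b) = θ a * θ b)
    (hθ_triv : ∀ a : ℚ_[p], ‖a‖ ≤ 1 → θ a = 1)
    (hθ_nontriv : ∃ a : ℚ_[p], ‖a‖ ≤ (p : ℝ) ∧ θ a ≠ 1) (ν₁ ν₂ : ℂ) (s : ℚ_[p]) :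
    ∫ u, ∫ c, kernel θ ν₁ ν₂ s u c ∂μ ∂μ =
      (if 1 ≤ ‖s‖ then
        (‖s‖ : ℂ) ^ (-1 - ν₁ - ν₂) * tailChar μ θ ν₂ ‖s‖ * tailChar μ θ ν₁ 1 else 0) * θ (-s) := by
  simp_rw [integral_kernel_third hθ_add hθ_triv hθ_nontriv]
  split_ifs with h
  swap
  · simp [h]
  have hs : 0 < ‖s‖ := one_pos.trans_le h
  have hs0 := norm_pos_iff.1 hs
  have hsC : (‖s‖ : ℂ) ≠ 0 := mod_cast hs.ne'
  have e : ∀ z, (if 1 ≤ ‖s‖ ∧ ‖s‖ < ‖s * z‖ then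
      (‖s‖ : ℂ) ^ (-1 - ν₂) * θ (-s) * tailChar μ θ ν₂ ‖s‖ *
        ((‖s * z‖ : ℂ) ^ (-1 - ν₁) * θ (-(s * z / s))) else 0) =
      (‖s‖ : ℂ) ^ (-1 - ν₂) * θ (-s) * tailChar μ θ ν₂ ‖s‖ * (‖s‖ : ℂ) ^ (-1 - ν₁) *
      ((if 1 < ‖z‖ * 1 ^ 2 then (‖z‖ : ℂ) ^ (-1 - ν₁) else 0) * θ (-z)) := by
    intro z
    simp only [h, true_and, norm_mul, lt_mul_iff_one_lt_right hs, one_pow, mul_one,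
      mul_div_cancel_left₀ z hs0]
    split_ifs
    · rw [Complex.ofReal_mul, Complex.mul_cpow_ofReal_nonneg (norm_nonneg _) (norm_nonneg _)]
      ring
    · simp
  rw [integral_mul_left hμ hs0]
  simp_rw [e]
  rw [integral_const_mul, ← tailChar, show -1 - ν₁ - ν₂ = 1 + (-1 - ν₁) + (-1 - ν₂) by ring,
    Complex.cpow_add _ _ hsC, Complex.cpow_add _ _ hsC, Complex.cpow_one]
  ring

lemma integral_kernel (hμ : μ {x : ℚ_[p] | ‖x‖ ≤ 1} = 1) (hθ_cont : Continuous θ)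
    (hθ_unit : ∀ a : ℚ_[p], ‖θ a‖ = 1) (hθ_add : ∀ a b : ℚ_[p], θ (a + b) = θ a * θ b)
    (hθ_triv : ∀ a : ℚ_[p], ‖a‖ ≤ 1 → θ a = 1)
    (hθ_nontriv : ∃ a : ℚ_[p], ‖a‖ ≤ (p : ℝ) ∧ θ a ≠ 1)
    {ν₁ ν₂ : ℂ} (hν₂ : 1 < ν₂.re) (hν : 1 < (ν₁ - ν₂).re) :
    ∫ q : ℚ_[p] × ℚ_[p] × ℚ_[p] × ℚ_[p],
      (if ‖q.1 - q.2.2.2‖ ≤ 1 then kernel θ ν₁ ν₂ q.1 q.2.1 q.2.2.1 else 0)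
      ∂(μ.prod (μ.prod (μ.prod μ))) =
        (1 - (p : ℂ)⁻¹) * (p : ℂ) ^ (-2 - ν₁ - ν₂) +
          (1 - (p : ℂ)⁻¹) * (p : ℂ) ^ (-2 - 2 * ν₁ - ν₂) +
          (1 - (p : ℂ)⁻¹) * (p : ℂ) ^ (-2 - 2 * ν₁) -
          (p : ℂ) ^ (-3 - 2 * ν₁ - 2 * ν₂) := by
  have h1 := one_lt_cast (p := p)
  have hpos := cast_pos (p := p)
  have hp0 : (p : ℂ) ≠ 0 := mod_cast hp.out.ne_zero
  have hI := integrable_kernel hμ hθ_cont hθ_unit hν₂ hν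
  have hx : ∀ s u c : ℚ_[p], ∫ x, (if ‖s - x‖ ≤ 1 then kernel θ ν₁ ν₂ s u c else 0) ∂μ =
      kernel θ ν₁ ν₂ s u c := by
    intro s u c
    have hS : MeasurableSet {x : ℚ_[p] | ‖s - x‖ ≤ 1} :=
      measurableSet_le (by fun_prop) (by fun_prop)
    have := integral_indicator_const (μ := μ) (kernel θ ν₁ ν₂ s u c) hS
    rw [Measure.real, measure_ball_sub hμ s, ENNReal.toReal_one, one_smul] at this
    refine Eq.trans ?_ this
    congr 1
  have hs : (fun s : ℚ_[p] => ∫ q : ℚ_[p] × ℚ_[p] × ℚ_[p],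
      (if ‖s - q.2.2‖ ≤ 1 then kernel θ ν₁ ν₂ s q.1 q.2.1 else 0) ∂(μ.prod (μ.prod μ))) =ᵐ[μ]
      fun s => (if 1 ≤ ‖s‖ then
        (‖s‖ : ℂ) ^ (-1 - ν₁ - ν₂) * tailChar μ θ ν₂ ‖s‖ * tailChar μ θ ν₁ 1 else 0) * θ (-s) := by
    filter_upwards [hI.prod_right_ae] with s hIs
    rw [← integral_kernel_second hμ hθ_add hθ_triv hθ_nontriv, integral_prod _ hIs]
    refine integral_congr_ae ?_
    filter_upwards [hIs.prod_right_ae] with u hIu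
    rw [integral_prod _ hIu]
    simp only [hx]
  have hg := integral_radial_mul_char hμ hθ_cont hθ_unit hθ_add hθ_triv hθ_nontriv
    (g := fun r => if 1 ≤ r then
      (r : ℂ) ^ (-1 - ν₁ - ν₂) * tailChar μ θ ν₂ r * tailChar μ θ ν₁ 1 else 0)
    (fun r hr => if_neg ?_) (hI.integral_prod_left.congr hs)
  · rw [integral_prod _ hI, integral_congr_ae hs, hg]
    have h2 : ¬ 1 ≤ (p : ℝ)⁻¹ := (inv_lt_one_of_one_lt₀ h1).not_ge
    have hν₁ : 0 < ν₁.re := by rw [Complex.sub_re] at hν; linarith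
    rw [if_neg h2, if_pos le_rfl, if_pos h1.le,
      tailChar_one hμ hθ_cont hθ_unit hθ_add hθ_triv hθ_nontriv hν₁,
      tailChar_one hμ hθ_cont hθ_unit hθ_add hθ_triv hθ_nontriv (by linarith : 0 < ν₂.re),
      tailChar_p hμ hθ_cont hθ_unit hθ_add hθ_triv hθ_nontriv (by linarith : 0 < ν₂.re),
      Complex.ofReal_one, Complex.one_cpow, Complex.ofReal_natCast,
      show -2 - ν₁ - ν₂ = (-1 - ν₁) + (-1 - ν₂) by ring,
      show -2 - 2 * ν₁ - ν₂ = (-1 - ν₁) + (-1 - ν₁ - ν₂) by ring,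
      show -2 - 2 * ν₁ = (-1 - ν₁) + (-1 - ν₁ - ν₂) + ν₂ by ring,
      show -3 - 2 * ν₁ - 2 * ν₂ = (-1 - ν₁) + (-1 - ν₁ - ν₂) + (-1 - ν₂) by ring]
    simp only [Complex.cpow_add _ _ hp0]
    ring
  · rw [not_le]
    exact hr.trans_lt (inv_lt_one_of_one_lt₀ (one_lt_pow₀ h1 two_ne_zero))

lemma integrable_and_integral_eq_change (hμ : μ {x : ℚ_[p] | ‖x‖ ≤ 1} = 1)
    {F : ℚ_[p] × ℚ_[p] × ℚ_[p] × ℚ_[p] → ℂ} (hF : Measurable F)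
    (h0 : ∀ q, q.2.1 + q.2.2.1 * q.2.2.2 = 0 → F q = 0)
    {K : ℚ_[p] × ℚ_[p] × ℚ_[p] × ℚ_[p] → ℂ} (hK : Integrable K (μ.prod (μ.prod (μ.prod μ))))
    (hFK : ∀ q, (‖q.2.1‖ : ℂ) * F (q.2.1 * (q.1 - 2 * q.2.2.2) + q.2.2.1 * q.2.2.2 ^ 2,
      q.2.1 - q.2.2.1 * q.2.2.2, q.2.2) = K q) :
    Integrable F (μ.prod (μ.prod (μ.prod μ))) ∧
      ∫ q, F q ∂(μ.prod (μ.prod (μ.prod μ))) = ∫ q, K q ∂(μ.prod (μ.prod (μ.prod μ))) := by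
  have hE : MeasurableSet {q : ℚ_[p] × ℚ_[p] × ℚ_[p] × ℚ_[p] | q.2.1 + q.2.2.1 * q.2.2.2 ≠ 0} :=
    (measurableSet_eq_fun (by fun_prop) (by fun_prop)).compl
  have hsupp : ({q : ℚ_[p] × ℚ_[p] × ℚ_[p] × ℚ_[p] | q.2.1 + q.2.2.1 * q.2.2.2 ≠ 0}).indicator F =
      F := by
    rw [Set.indicator_eq_self]
    exact fun q hq h => hq (h0 q h)
  have hΨ : Measurable fun q : ℚ_[p] × ℚ_[p] × ℚ_[p] × ℚ_[p] =>
      (q.2.1 * (q.1 - 2 * q.2.2.2) + q.2.2.1 * q.2.2.2 ^ 2, q.2.1 - q.2.2.1 * q.2.2.2, q.2.2) := by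
    fun_prop
  have hd : Measurable fun q : ℚ_[p] × ℚ_[p] × ℚ_[p] × ℚ_[p] => ‖q.2.1‖₊ := by fun_prop
  have hsmul : ∀ q, ‖q.2.1‖₊ • F (q.2.1 * (q.1 - 2 * q.2.2.2) + q.2.2.1 * q.2.2.2 ^ 2,
      q.2.1 - q.2.2.1 * q.2.2.2, q.2.2) = K q := by
    intro q
    rw [← hFK, NNReal.smul_def, coe_nnnorm, Complex.real_smul]
  rw [← hsupp, integrable_indicator_iff hE, integral_indicator hE, IntegrableOn,
    ← map_withDensity_change hμ,
    integrable_map_measure hF.aestronglyMeasurable hΨ.aemeasurable,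
    integral_map hΨ.aemeasurable hF.aestronglyMeasurable,
    integrable_withDensity_iff_integrable_smul hd, integral_withDensity_eq_integral_smul hd]
  simpa only [Function.comp_def, hsmul, and_true] using hK

end PadicIntegral

/-- For `Re(ν₂)` and `Re(ν₁−ν₂)` large enough, with `(a,b,c,x) = q`,
the function `|b+cx|^{−1−ν₁+ν₂}·|ac−b²|^{−1−ν₂}·θ(−x−c)` is absolutely integrable on
`R = {min{v(a),v(b),v(c)} > v(ac−b²), v(b+cx) ≤ v(a+bx), b+cx ≠ 0}` and its integral is
`(1−p⁻¹)p^{−2−ν₁−ν₂} + (1−p⁻¹)p^{−2−2ν₁−ν₂} + (1−p⁻¹)p^{−2−2ν₁} − p^{−3−2ν₁−2ν₂}`. -/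
theorem stmt_16 (p : ℕ) [Fact p.Prime]
    [MeasurableSpace ℚ_[p]] [BorelSpace ℚ_[p]]
    (μ : Measure ℚ_[p]) [SigmaFinite μ]
    (hμ_inv : ∀ a : ℚ_[p], μ.map (a + ·) = μ)
    (hμ_norm : μ {x : ℚ_[p] | ‖x‖ ≤ 1} = 1)
    (θ : ℚ_[p] → ℂ) (hθ_cont : Continuous θ)
    (hθ_add : ∀ a b : ℚ_[p], θ (a + b) = θ a * θ b)
    (hθ_unit : ∀ a : ℚ_[p], ‖θ a‖ = 1)
    (hθ_triv : ∀ a : ℚ_[p], ‖a‖ ≤ 1 → θ a = 1)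
    (hθ_nontriv : ∃ a : ℚ_[p], ‖a‖ ≤ (p : ℝ) ∧ θ a ≠ 1) :
    ∃ T : ℝ, ∀ ν₁ ν₂ : ℂ, T < ν₂.re → T < (ν₁ - ν₂).re →
      IntegrableOn
        (fun q : ℚ_[p] × ℚ_[p] × ℚ_[p] × ℚ_[p] =>
          (‖q.2.1 + q.2.2.1 * q.2.2.2‖ : ℂ) ^ (-1 - ν₁ + ν₂) *
            (‖q.1 * q.2.2.1 - q.2.1 ^ 2‖ : ℂ) ^ (-1 - ν₂) * θ (-q.2.2.2 - q.2.2.1))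
        {q : ℚ_[p] × ℚ_[p] × ℚ_[p] × ℚ_[p] | Padic.addValuation (q.1 * q.2.2.1 - q.2.1 ^ 2) <
            min (Padic.addValuation q.1)
              (min (Padic.addValuation q.2.1) (Padic.addValuation q.2.2.1)) ∧
          Padic.addValuation (q.2.1 + q.2.2.1 * q.2.2.2) ≤
            Padic.addValuation (q.1 + q.2.1 * q.2.2.2) ∧
          q.2.1 + q.2.2.1 * q.2.2.2 ≠ 0}
        (μ.prod (μ.prod (μ.prod μ))) ∧
      ∫ q in {q : ℚ_[p] × ℚ_[p] × ℚ_[p] × ℚ_[p] | Padic.addValuation (q.1 * q.2.2.1 - q.2.1 ^ 2) <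
            min (Padic.addValuation q.1)
              (min (Padic.addValuation q.2.1) (Padic.addValuation q.2.2.1)) ∧
          Padic.addValuation (q.2.1 + q.2.2.1 * q.2.2.2) ≤
            Padic.addValuation (q.1 + q.2.1 * q.2.2.2) ∧
          q.2.1 + q.2.2.1 * q.2.2.2 ≠ 0},
          (‖q.2.1 + q.2.2.1 * q.2.2.2‖ : ℂ) ^ (-1 - ν₁ + ν₂) *
            (‖q.1 * q.2.2.1 - q.2.1 ^ 2‖ : ℂ) ^ (-1 - ν₂) * θ (-q.2.2.2 - q.2.2.1)
          ∂(μ.prod (μ.prod (μ.prod μ))) =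
        (1 - (p : ℂ)⁻¹) * (p : ℂ) ^ (-2 - ν₁ - ν₂) +
          (1 - (p : ℂ)⁻¹) * (p : ℂ) ^ (-2 - 2 * ν₁ - ν₂) +
          (1 - (p : ℂ)⁻¹) * (p : ℂ) ^ (-2 - 2 * ν₁) -
          (p : ℂ) ^ (-3 - 2 * ν₁ - 2 * ν₂) := by
  have := PadicIntegral.isAddHaarMeasure hμ_inv hμ_norm
  have hθ := hθ_cont.measurable
  refine ⟨1, fun ν₁ ν₂ hν₂ hν => ?_⟩
  rw [PadicIntegral.setOf_addValuation_eq]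
  have hR : MeasurableSet {q : ℚ_[p] × ℚ_[p] × ℚ_[p] × ℚ_[p] |
      ‖q.1 * q.2.2.1 - q.2.1 ^ 2‖ > max ‖q.1‖ (max ‖q.2.1‖ ‖q.2.2.1‖) ∧
      ‖q.1 + q.2.1 * q.2.2.2‖ ≤ ‖q.2.1 + q.2.2.1 * q.2.2.2‖ ∧
      q.2.1 + q.2.2.1 * q.2.2.2 ≠ 0} :=
    PadicIntegral.measurableSet_and (measurableSet_lt (by fun_prop) (by fun_prop))
      (PadicIntegral.measurableSet_and (measurableSet_le (by fun_prop) (by fun_prop))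
        (measurableSet_eq_fun (by fun_prop) (by fun_prop)).compl)
  rw [← integrable_indicator_iff hR, ← integral_indicator hR,
    ← PadicIntegral.integral_kernel hμ_norm hθ_cont hθ_unit hθ_add hθ_triv hθ_nontriv hν₂ hν]
  refine PadicIntegral.integrable_and_integral_eq_change hμ_norm
    (Measurable.indicator (by fun_prop) hR)
    (fun q hq => Set.indicator_of_notMem (fun h => h.2.2 hq) _)
    (PadicIntegral.integrable_kernel hμ_norm hθ_cont hθ_unit hν₂ hν) fun q =>
      PadicIntegral.norm_mul_integrand_change hθ_add hθ_triv ν₁ ν₂ _ _ _ _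
end

section
/- Let p be a prime and θ as below. Let R = { (a,b,c,x) ∈ ℚ_p⁴ : v_p(a) ≤ min{−1, v_p(b) − 1, v_p(ac − b²)} and v_p(a + bx) < v_p(x) } (so in particular a ≠ 0 and a + bx ≠ 0 on R). There exists T ∈ ℝ such that for all ν₁, ν₂ ∈ ℂ with Re(ν₂) > T and Re(ν₁ − ν₂) > T, the function (a,b,c,x) ↦ |a + bx|^{−1−ν₁+ν₂} · |a|^{−1−ν₂} · θ(−x − c) is absolutely integrable on R and ∫_R |a + bx|^{−1−ν₁+ν₂} |a|^{−1−ν₂} θ(−x − c) da db dc dx = (1 − p⁻¹)·p^{−1−ν₁} + (1 − p⁻¹)·p^{−2−2ν₁} + (1 − p⁻¹)·p^{−2−2ν₁−ν₂} − p^{−3−3ν₁}. -/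
open MeasureTheory

section PadicHaar

variable {p : ℕ} [Fact p.Prime]

lemma Padic.norm_le_one_iff_lt_prime (x : ℚ_[p]) : ‖x‖ ≤ 1 ↔ ‖x‖ < p := by
  simpa using Padic.norm_le_pow_iff_norm_lt_pow_add_one x 0

lemma Padic.one_lt_norm_iff (x : ℚ_[p]) : 1 < ‖x‖ ↔ (p : ℝ) ≤ ‖x‖ := by
  rw [← not_le, Padic.norm_le_one_iff_lt_prime, not_lt]

lemma Padic.one_lt_prime_mul_norm_iff (x : ℚ_[p]) : 1 < p * ‖x‖ ↔ 1 ≤ ‖x‖ := by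
  have h := Padic.norm_le_pow_iff_norm_lt_pow_add_one x (-1)
  have hp : (0 : ℝ) < p := mod_cast (Fact.out : p.Prime).pos
  simp only [zpow_neg, zpow_one, neg_add_cancel, zpow_zero] at h
  rw [← not_le, not_iff_comm, not_le, ← h, ← one_div, le_div_iff₀ hp, mul_comm]

lemma Padic.norm_add_eq_of_lt {x y : ℚ_[p]} (h : ‖x‖ < ‖y‖) : ‖x + y‖ = ‖y‖ := by
  rw [Padic.add_eq_max_of_ne h.ne, max_eq_right h.le]

lemma Padic.exists_norm_eq_zpow {x : ℚ_[p]} (hx : x ≠ 0) : ∃ n : ℤ, ‖x‖ = (p : ℝ) ^ n :=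
  ⟨_, Padic.norm_eq_zpow_neg_valuation hx⟩

variable [MeasurableSpace ℚ_[p]] [BorelSpace ℚ_[p]] {μ : Measure ℚ_[p]} [μ.IsAddHaarMeasure]

lemma Padic.measurableSet_norm_le (r : ℝ) : MeasurableSet {x : ℚ_[p] | ‖x‖ ≤ r} :=
  measurableSet_le measurable_norm measurable_const

lemma Padic.measure_ball_succ (n : ℤ) :
    μ {x : ℚ_[p] | ‖x‖ ≤ (p : ℝ) ^ (n + 1)} = p * μ {x : ℚ_[p] | ‖x‖ ≤ (p : ℝ) ^ n} := by
  have hp0 : (p : ℚ_[p]) ≠ 0 := mod_cast (Fact.out : p.Prime).ne_zero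
  have hp : (0 : ℝ) < p := mod_cast (Fact.out : p.Prime).pos
  have hnorm (i : ℤ) (j : ℤ) : ‖(p : ℚ_[p]) ^ (n + 1) *
      ((p : ℚ_[p]) ^ (-(n + 1)) * i - (p : ℚ_[p]) ^ (-(n + 1)) * j)‖ = ‖((i - j : ℤ) : ℚ_[p])‖ := by
    rw [← mul_sub, ← mul_assoc, ← zpow_add₀ hp0]; simp
  have hset : {x : ℚ_[p] | ‖x‖ ≤ (p : ℝ) ^ (n + 1)} =
      ⋃ i ∈ Finset.range p, (fun x ↦ -((p : ℚ_[p]) ^ (-(n + 1)) * (i : ℕ)) + x) ⁻¹'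
        {x : ℚ_[p] | ‖x‖ ≤ (p : ℝ) ^ n} := by
    ext x
    simp only [Set.mem_ofPred_eq, Set.mem_iUnion, Set.mem_preimage, Finset.mem_range, exists_prop]
    constructor
    · intro hx
      have hz : ‖(p : ℚ_[p]) ^ (n + 1) * x‖ ≤ 1 := by
        rw [norm_mul, Padic.norm_p_zpow, zpow_neg, inv_mul_le_iff₀ (by positivity), mul_one]
        exact hx
      obtain ⟨z, hzx⟩ : ∃ z : ℤ_[p], (z : ℚ_[p]) = (p : ℚ_[p]) ^ (n + 1) * x := ⟨⟨_, hz⟩, rfl⟩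
      obtain ⟨i, hi, him⟩ := PadicInt.exists_mem_range z
      refine ⟨i, hi, ?_⟩
      rw [PadicInt.maximalIdeal_eq_span_p, Ideal.mem_span_singleton,
        ← PadicInt.norm_lt_one_iff_dvd] at him
      have him' : ‖(p : ℚ_[p]) ^ (n + 1) * x - i‖ < 1 := by
        rwa [PadicInt.norm_def, PadicInt.coe_sub, PadicInt.coe_natCast, hzx] at him
      have : -((p : ℚ_[p]) ^ (-(n + 1)) * i) + x =
          (p : ℚ_[p]) ^ (-(n + 1)) * ((p : ℚ_[p]) ^ (n + 1) * x - i) := by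
        rw [mul_sub, ← mul_assoc, ← zpow_add₀ hp0, neg_add_cancel, zpow_zero]; ring
      rw [Padic.norm_le_pow_iff_norm_lt_pow_add_one, this, norm_mul, Padic.norm_p_zpow, neg_neg]
      exact mul_lt_of_lt_one_right (by positivity) him'
    · rintro ⟨i, hi, h⟩
      rw [← add_neg_cancel_left ((p : ℚ_[p]) ^ (-(n + 1)) * i) x]
      refine (Padic.nonarchimedean _ _).trans (max_le ?_ (h.trans ?_))
      · rw [norm_mul, Padic.norm_p_zpow, neg_neg]
        exact mul_le_of_le_one_right (by positivity)
          (by exact_mod_cast Padic.norm_int_le_one (p := p) i)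
      · exact zpow_le_zpow_right₀ (mod_cast (Fact.out : p.Prime).one_lt.le) (by lia)
  rw [hset, measure_biUnion_finset]
  · simp only [measure_preimage_add, Finset.sum_const, Finset.card_range, nsmul_eq_mul]
  · intro i hi j hj hij
    refine Set.disjoint_left.2 fun x hx hx' ↦ hij ?_
    simp only [Set.mem_preimage, Set.mem_ofPred_eq] at hx hx'
    have h1 : ‖(p : ℚ_[p]) ^ (-(n + 1)) * (i : ℤ) - (p : ℚ_[p]) ^ (-(n + 1)) * (j : ℤ)‖ <
        (p : ℝ) ^ (n + 1) := by
      rw [← Padic.norm_le_pow_iff_norm_lt_pow_add_one]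
      have : (p : ℚ_[p]) ^ (-(n + 1)) * (i : ℤ) - (p : ℚ_[p]) ^ (-(n + 1)) * (j : ℤ) =
        (-((p : ℚ_[p]) ^ (-(n + 1)) * j) + x) - (-((p : ℚ_[p]) ^ (-(n + 1)) * i) + x) := by
        push_cast; ring
      rw [this]
      rw [sub_eq_add_neg]
      exact (Padic.nonarchimedean _ _).trans (max_le hx' (by rwa [norm_neg]))
    have h2 : ‖((i - j : ℤ) : ℚ_[p])‖ < 1 := by
      rw [← hnorm, norm_mul, Padic.norm_p_zpow, zpow_neg, inv_mul_lt_iff₀ (by positivity), mul_one]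
      exact h1
    rw [Padic.norm_intCast_lt_one_iff] at h2
    have := Int.eq_zero_of_abs_lt_dvd h2 (by
      have := Finset.mem_range.1 hi
      have := Finset.mem_range.1 hj
      rw [abs_lt]
      constructor <;> lia)
    lia
  · intro i _
    exact (Padic.measurableSet_norm_le _).preimage (measurable_const_add _)

lemma Padic.measure_ball (hμ : μ {x : ℚ_[p] | ‖x‖ ≤ 1} = 1) (n : ℤ) :
    μ {x : ℚ_[p] | ‖x‖ ≤ (p : ℝ) ^ n} = (p : ENNReal) ^ n := by
  have hp0 : (p : ENNReal) ≠ 0 := mod_cast (Fact.out : p.Prime).ne_zero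
  have hpt : (p : ENNReal) ≠ ⊤ := ENNReal.natCast_ne_top p
  induction n using Int.induction_on with
  | zero => simpa using hμ
  | succ n ih => rw [Padic.measure_ball_succ, ih, ENNReal.zpow_add hp0 hpt, zpow_one, mul_comm]
  | pred n ih =>
    have h := Padic.measure_ball_succ (μ := μ) (p := p) (-n - 1)
    rw [sub_add_cancel, ih] at h
    rw [sub_eq_add_neg, ENNReal.zpow_add hp0 hpt, h, zpow_neg_one, mul_comm, ← mul_assoc,
      ENNReal.inv_mul_cancel hp0 hpt, one_mul]
    rfl

lemma Padic.measureReal_ball (hμ : μ {x : ℚ_[p] | ‖x‖ ≤ 1} = 1) (n : ℤ) :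
    μ.real {x : ℚ_[p] | ‖x‖ ≤ (p : ℝ) ^ n} = (p : ℝ) ^ n := by
  rw [measureReal_def, Padic.measure_ball hμ, ← ENNReal.rpow_intCast, ← ENNReal.toReal_rpow,
    ENNReal.toReal_natCast, Real.rpow_intCast]

lemma Padic.map_mul_left_eq_smul (hμ : μ {x : ℚ_[p] | ‖x‖ ≤ 1} = 1) {c : ℚ_[p]} (hc : c ≠ 0) :
    μ.map (c * ·) = ‖c‖₊⁻¹ • μ := by
  have hm : Measurable (c * · : ℚ_[p] → ℚ_[p]) := measurable_const_mul c
  have : (μ.map (c * ·)).IsAddHaarMeasure :=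
    AddEquiv.isAddHaarMeasure_map μ (DistribMulAction.toAddEquiv₀ ℚ_[p] c hc)
      (continuous_const_mul c) (continuous_const_mul c⁻¹)
  have h := Measure.isAddLeftInvariant_eq_smul (μ.map (c * ·)) μ
  have h1 := congrArg (fun ν : Measure ℚ_[p] ↦ ν {x : ℚ_[p] | ‖x‖ ≤ 1}) h
  obtain ⟨n, hn⟩ := Padic.exists_norm_eq_zpow hc
  have hp : (0 : ℝ) < p := mod_cast (Fact.out : p.Prime).pos
  have hpre : (c * ·) ⁻¹' {x : ℚ_[p] | ‖x‖ ≤ 1} = {x : ℚ_[p] | ‖x‖ ≤ (p : ℝ) ^ (-n)} := by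
    ext x
    simp only [Set.mem_preimage, Set.mem_ofPred_eq, norm_mul, hn, zpow_neg]
    rw [mul_comm, ← le_div_iff₀ (by positivity), one_div]
  rw [Measure.map_apply hm (Padic.measurableSet_norm_le 1), hpre, Measure.smul_apply, hμ,
    Padic.measure_ball hμ] at h1
  have h2 : Measure.addHaarScalarFactor (μ.map (c * ·)) μ = ‖c‖₊⁻¹ := by
    have h3 := congrArg ENNReal.toReal h1
    rw [← ENNReal.rpow_intCast, ← ENNReal.toReal_rpow, ENNReal.toReal_natCast, Real.rpow_intCast,
      zpow_neg, ← hn] at h3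
    ext
    simpa [ENNReal.smul_def] using h3.symm
  rw [h, h2]

lemma Padic.measurableEmbedding_mul_left {c : ℚ_[p]} (hc : c ≠ 0) :
    MeasurableEmbedding (c * · : ℚ_[p] → ℚ_[p]) :=
  (Homeomorph.mulLeft₀ c hc).measurableEmbedding

lemma Padic.norm_smul_integral_comp_mul_left (hμ : μ {x : ℚ_[p] | ‖x‖ ≤ 1} = 1) {c : ℚ_[p]}
    (hc : c ≠ 0) {E : Type*} [NormedAddCommGroup E] [NormedSpace ℝ E] (f : ℚ_[p] → E) :
    ‖c‖ • ∫ x, f (c * x) ∂μ = ∫ x, f x ∂μ := by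
  rw [← (Padic.measurableEmbedding_mul_left hc).integral_map, Padic.map_mul_left_eq_smul hμ hc,
    integral_smul_nnreal_measure, NNReal.smul_def, smul_smul]
  simp [hc]

lemma Padic.integrable_comp_mul_left (hμ : μ {x : ℚ_[p] | ‖x‖ ≤ 1} = 1) {c : ℚ_[p]}
    (hc : c ≠ 0) {E : Type*} [NormedAddCommGroup E] {f : ℚ_[p] → E} (hf : Integrable f μ) :
    Integrable (fun x ↦ f (c * x)) μ := by
  refine (integrable_map_measure (μ := μ) ?_ (measurable_const_mul c).aemeasurable).1 ?_ <;>
    rw [Padic.map_mul_left_eq_smul hμ hc]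
  · exact hf.aestronglyMeasurable.smul_measure _
  · exact hf.smul_measure_nnreal

lemma Padic.integrable_inv_max_one_norm_sq (hμ : μ {x : ℚ_[p] | ‖x‖ ≤ 1} = 1) :
    Integrable (fun x : ℚ_[p] ↦ (max 1 ‖x‖ ^ 2)⁻¹) μ := by
  have hp1 : (1 : ℝ) < p := mod_cast (Fact.out : p.Prime).one_lt
  have hp : (0 : ℝ) < p := by positivity
  have hp0 : (p : ENNReal) ≠ 0 := mod_cast (Fact.out : p.Prime).ne_zero
  have hpt : (p : ENNReal) ≠ ⊤ := ENNReal.natCast_ne_top p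
  have hmeas : Measurable (fun x : ℚ_[p] ↦ (max 1 ‖x‖ ^ 2)⁻¹) := by fun_prop
  refine ⟨hmeas.aestronglyMeasurable, ?_⟩
  set g : ℕ → ℚ_[p] → ENNReal := fun n ↦
    {x : ℚ_[p] | ‖x‖ ≤ (p : ℝ) ^ (n : ℤ)}.indicator (fun _ ↦ ((p : ENNReal)⁻¹ ^ n) ^ 2) with hg
  have hle (x : ℚ_[p]) : ‖(max 1 ‖x‖ ^ 2)⁻¹‖ₑ ≤ ∑' n : ℕ, g n x := by
    obtain ⟨n, hn, hx⟩ : ∃ n : ℕ, max 1 ‖x‖ = (p : ℝ) ^ n ∧ ‖x‖ ≤ (p : ℝ) ^ (n : ℤ) := by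
      rcases le_or_gt ‖x‖ 1 with h | h
      · exact ⟨0, by simp [h], by simpa using h⟩
      · obtain ⟨n, hn⟩ := Padic.exists_norm_eq_zpow (x := x) (by rintro rfl; simp at h; linarith)
        have : 0 < n := by
          by_contra! hn0
          exact absurd (hn ▸ h) (not_lt.2 (zpow_le_one_of_nonpos₀ hp1.le hn0))
        lift n to ℕ using this.le
        exact ⟨n, by rw [max_eq_right h.le, hn, zpow_natCast], hn.le⟩
    refine le_trans ?_ (ENNReal.le_tsum n)
    simp only [hg]
    rw [Set.indicator_of_mem (show x ∈ {x : ℚ_[p] | ‖x‖ ≤ (p : ℝ) ^ (n : ℤ)} from hx), hn,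
      enorm_inv (by positivity), enorm_pow, enorm_pow, Real.enorm_natCast, ENNReal.inv_pow,
      ENNReal.inv_pow]
  calc ∫⁻ x, ‖(max 1 ‖x‖ ^ 2)⁻¹‖ₑ ∂μ ≤ ∫⁻ x, ∑' n : ℕ, g n x ∂μ := lintegral_mono hle
    _ = ∑' n : ℕ, (p : ENNReal)⁻¹ ^ n := by
      rw [lintegral_tsum fun n ↦
        (measurable_const.indicator (Padic.measurableSet_norm_le _)).aemeasurable]
      refine tsum_congr fun n ↦ ?_
      rw [lintegral_indicator_const (Padic.measurableSet_norm_le _), Padic.measure_ball hμ, sq,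
        mul_assoc, zpow_natCast, ← mul_pow, ENNReal.inv_mul_cancel hp0 hpt, one_pow, mul_one]
    _ < ⊤ := by
      rw [ENNReal.tsum_geometric, ENNReal.inv_lt_top, tsub_pos_iff_lt, ENNReal.inv_lt_one]
      exact_mod_cast (Fact.out : p.Prime).one_lt

end PadicHaar

/-- Continuous unitary additive characters of `ℚ_[p]` which are trivial on `ℤ_[p]` but not
on `p⁻¹ℤ_[p]`. -/
structure Padic.IsStdChar {p : ℕ} [Fact p.Prime] (θ : ℚ_[p] → ℂ) : Prop where
  continuous : Continuous θ
  map_add : ∀ a b : ℚ_[p], θ (a + b) = θ a * θ b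
  norm_eq_one : ∀ a : ℚ_[p], ‖θ a‖ = 1
  eq_one : ∀ a : ℚ_[p], ‖a‖ ≤ 1 → θ a = 1
  exists_ne_one : ∃ a : ℚ_[p], ‖a‖ ≤ (p : ℝ) ∧ θ a ≠ 1

lemma Padic.norm_add_le_iff {p : ℕ} [Fact p.Prime] {x a : ℚ_[p]} {r : ℝ} (ha : ‖a‖ ≤ r) :
    ‖a + x‖ ≤ r ↔ ‖x‖ ≤ r := by
  constructor <;> intro h
  · rw [← neg_add_cancel_left a x]
    exact (Padic.nonarchimedean _ _).trans (max_le (by rwa [norm_neg]) h)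
  · exact (Padic.nonarchimedean _ _).trans (max_le ha h)

lemma Padic.IsStdChar.integrable_mul {p : ℕ} [Fact p.Prime] [MeasurableSpace ℚ_[p]]
    [BorelSpace ℚ_[p]] {μ : Measure ℚ_[p]} {θ : ℚ_[p] → ℂ} (hθ : Padic.IsStdChar θ) {f : ℚ_[p] → ℂ}
    (hf : Integrable f μ) : Integrable (fun x ↦ f x * θ x) μ :=
  hf.mul_bdd (c := 1) hθ.continuous.aestronglyMeasurable (.of_forall fun x ↦ (hθ.norm_eq_one x).le)

lemma Padic.IsStdChar.neg {p : ℕ} [Fact p.Prime] {θ : ℚ_[p] → ℂ} (hθ : Padic.IsStdChar θ) :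
    Padic.IsStdChar fun x ↦ θ (-x) :=
  ⟨hθ.continuous.comp continuous_neg, fun a b ↦ by rw [neg_add, hθ.map_add],
    fun a ↦ hθ.norm_eq_one _, fun a h ↦ hθ.eq_one _ (by rwa [norm_neg]),
    hθ.exists_ne_one.imp' (- ·) (by simp)⟩

lemma Padic.IsStdChar.measurable {p : ℕ} [Fact p.Prime] [MeasurableSpace ℚ_[p]]
    [BorelSpace ℚ_[p]] {θ : ℚ_[p] → ℂ} (hθ : Padic.IsStdChar θ) : Measurable θ :=
  hθ.continuous.measurable

section RadialIntegrals

variable {p : ℕ} [Fact p.Prime] [MeasurableSpace ℚ_[p]] [BorelSpace ℚ_[p]]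
  {μ : Measure ℚ_[p]} [μ.IsAddHaarMeasure]

lemma Padic.IsStdChar.integral_mul_eq_zero {θ : ℚ_[p] → ℂ} (hθ : Padic.IsStdChar θ) {f : ℚ_[p] → ℂ}
    (hf : ∀ x a : ℚ_[p], ‖a‖ ≤ p → f (a + x) = f x) : ∫ x, f x * θ x ∂μ = 0 := by
  obtain ⟨a, ha, hne⟩ := hθ.exists_ne_one
  have h := integral_add_left_eq_self (μ := μ) (fun x ↦ f x * θ x) a
  simp only [hf _ a ha, hθ.map_add, mul_left_comm _ (θ a)] at h
  rw [integral_const_mul] at h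
  exact (mul_eq_zero.1 (by linear_combination h :
    (θ a - 1) * ∫ x, f x * θ x ∂μ = 0)).resolve_left (sub_ne_zero.2 hne)

lemma Padic.integrable_indicator_ball (r : ℝ) (c : ℂ) :
    Integrable ({x : ℚ_[p] | ‖x‖ ≤ r}.indicator fun _ ↦ c) μ := by
  refine (integrable_indicator_iff (Padic.measurableSet_norm_le r)).2 (integrableOn_const ?_)
  have : {x : ℚ_[p] | ‖x‖ ≤ r} = Metric.closedBall 0 r := by ext; simp
  rw [this]
  exact (isCompact_closedBall (0 : ℚ_[p]) r).measure_lt_top.ne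

lemma Padic.IsStdChar.integral_radial_mul {θ : ℚ_[p] → ℂ} (hθ : Padic.IsStdChar θ)
    (hμ : μ {x : ℚ_[p] | ‖x‖ ≤ 1} = 1) {G : ℝ → ℂ} (hG : Integrable (fun x : ℚ_[p] ↦ G ‖x‖) μ) :
    ∫ x, G ‖x‖ * θ x ∂μ = ∫ x in {x : ℚ_[p] | ‖x‖ ≤ 1}, G ‖x‖ ∂μ - G p := by
  have hp1 : (1 : ℝ) ≤ p := mod_cast (Fact.out : p.Prime).one_lt.le
  set f₁ : ℚ_[p] → ℂ := {x : ℚ_[p] | ‖x‖ ≤ 1}.indicator fun x ↦ G ‖x‖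
  set f₂ : ℚ_[p] → ℂ := {x : ℚ_[p] | ‖x‖ ≤ 1}.indicator fun _ ↦ G p
  set f₃ : ℚ_[p] → ℂ := {x : ℚ_[p] | ‖x‖ ≤ p}.indicator fun _ ↦ G p with hf₃
  set f₄ : ℚ_[p] → ℂ := {x : ℚ_[p] | ‖x‖ ≤ p}ᶜ.indicator fun x ↦ G ‖x‖ with hf₄
  have h₁ : Integrable f₁ μ := hG.indicator (Padic.measurableSet_norm_le 1)
  have h₂ : Integrable f₂ μ := Padic.integrable_indicator_ball 1 _
  have h₃ : Integrable f₃ μ := Padic.integrable_indicator_ball p _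
  have h₄ : Integrable f₄ μ := hG.indicator (Padic.measurableSet_norm_le p).compl
  have hsplit : (fun x : ℚ_[p] ↦ G ‖x‖ * θ x) =
      fun x ↦ (f₁ x - f₂ x) + f₃ x * θ x + f₄ x * θ x := by
    ext x
    by_cases hx : ‖x‖ ≤ 1
    · simp [f₁, f₂, f₃, f₄, hx, hx.trans hp1, hθ.eq_one x hx]
    · by_cases hx' : ‖x‖ ≤ p
      · have : ‖x‖ = p := le_antisymm hx' ((Padic.one_lt_norm_iff x).1 (not_le.1 hx))
        simp [f₁, f₂, f₃, f₄, this, this ▸ hx]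
      · simp [f₁, f₂, f₃, f₄, hx, hx']
  have z₃ : ∫ x, f₃ x * θ x ∂μ = 0 := hθ.integral_mul_eq_zero fun x a ha ↦ by
    simp only [hf₃, Set.indicator, Set.mem_ofPred_eq, Padic.norm_add_le_iff ha]
  have z₄ : ∫ x, f₄ x * θ x ∂μ = 0 := hθ.integral_mul_eq_zero fun x a ha ↦ by
    simp only [hf₄, Set.indicator, Set.mem_compl_iff, Set.mem_ofPred_eq, Padic.norm_add_le_iff ha]
    split_ifs with h
    · rfl
    · rw [Padic.norm_add_eq_of_lt (ha.trans_lt (not_le.1 h))]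
  have h₁₂ : Integrable (fun x ↦ f₁ x - f₂ x) μ := h₁.sub h₂
  have h₁₃ : Integrable (fun x ↦ f₁ x - f₂ x + f₃ x * θ x) μ := h₁₂.add (hθ.integrable_mul h₃)
  rw [hsplit, integral_add h₁₃ (hθ.integrable_mul h₄), integral_add h₁₂ (hθ.integrable_mul h₃),
    integral_sub h₁ h₂, z₃, z₄,
    integral_indicator (Padic.measurableSet_norm_le 1),
    integral_indicator_const _ (Padic.measurableSet_norm_le 1), measureReal_def, hμ]
  simp

lemma Padic.IsStdChar.integral_radial_mul_neg {θ : ℚ_[p] → ℂ} (hθ : Padic.IsStdChar θ)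
    (hμ : μ {x : ℚ_[p] | ‖x‖ ≤ 1} = 1) {G : ℝ → ℂ} (hG : Integrable (fun x : ℚ_[p] ↦ G ‖x‖) μ) :
    ∫ x, G ‖x‖ * θ (-x) ∂μ = ∫ x in {x : ℚ_[p] | ‖x‖ ≤ 1}, G ‖x‖ ∂μ - G p := by
  rw [← hθ.integral_radial_mul hμ hG, ← integral_neg_eq_self]
  simp

lemma Padic.setIntegral_unit_sphere (hμ : μ {x : ℚ_[p] | ‖x‖ ≤ 1} = 1) (c : ℂ) :
    ∫ x in {x : ℚ_[p] | ‖x‖ ≤ 1}, (if 1 ≤ ‖x‖ then c else 0) ∂μ = (1 - (p : ℂ)⁻¹) * c := by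
  have hball (n : ℤ) : MeasurableSet {x : ℚ_[p] | ‖x‖ ≤ (p : ℝ) ^ n} :=
    Padic.measurableSet_norm_le _
  have hf : (fun x : ℚ_[p] ↦ {x : ℚ_[p] | ‖x‖ ≤ 1}.indicator
      (fun x ↦ if 1 ≤ ‖x‖ then c else 0) x) = fun x ↦
      {x : ℚ_[p] | ‖x‖ ≤ (p : ℝ) ^ (0 : ℤ)}.indicator (fun _ ↦ c) x -
      {x : ℚ_[p] | ‖x‖ ≤ (p : ℝ) ^ (-1 : ℤ)}.indicator (fun _ ↦ c) x := by
    ext x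
    have := Padic.norm_le_pow_iff_norm_lt_pow_add_one x (-1)
    simp only [Set.indicator, Set.mem_ofPred_eq, this, neg_add_cancel, zpow_zero]
    split_ifs <;> first | (exfalso; linarith) | simp
  rw [← integral_indicator (Padic.measurableSet_norm_le 1), hf,
    integral_sub (Padic.integrable_indicator_ball _ _) (Padic.integrable_indicator_ball _ _),
    integral_indicator_const _ (hball 0), integral_indicator_const _ (hball (-1)),
    Padic.measureReal_ball hμ, Padic.measureReal_ball hμ]
  simp [sub_mul]

end RadialIntegrals

/-- The power `r ^ s`, truncated to `t < r`. -/
noncomputable def cpowAbove (t : ℝ) (s : ℂ) (r : ℝ) : ℂ := if t < r then (r : ℂ) ^ s else 0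

lemma cpowAbove_mul {c r : ℝ} (hc : 0 < c) (hr : 0 ≤ r) (t : ℝ) (s : ℂ) :
    cpowAbove (c * t) s (c * r) = (c : ℂ) ^ s * cpowAbove t s r := by
  simp only [cpowAbove, mul_lt_mul_iff_right₀ hc, Complex.ofReal_mul,
    Complex.mul_cpow_ofReal_nonneg hc.le hr]
  split_ifs <;> simp

lemma norm_cpowAbove_le {t r : ℝ} {s : ℂ} (ht : 1 ≤ t) (hs : s.re ≤ -2) :
    ‖cpowAbove t s r‖ ≤ (max 1 r ^ 2)⁻¹ := by
  unfold cpowAbove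
  split_ifs with h
  · have hr : 1 ≤ r := ht.trans h.le
    rw [Complex.norm_cpow_eq_rpow_re_of_pos (by linarith), max_eq_right hr, ← Real.rpow_natCast,
      ← Real.rpow_neg (by linarith)]
    exact Real.rpow_le_rpow_of_exponent_le hr (by simpa using hs)
  · simp

lemma norm_cpowAbove_le_one {t r : ℝ} {s : ℂ} (ht : 1 ≤ t) (hs : s.re ≤ -2) :
    ‖cpowAbove t s r‖ ≤ 1 :=
  (norm_cpowAbove_le ht hs).trans (inv_le_one_of_one_le₀ (one_le_pow₀ (le_max_left _ _)))

@[fun_prop]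
lemma Measurable.cpowAbove {α : Type*} [MeasurableSpace α] {t r : α → ℝ} (ht : Measurable t)
    (hr : Measurable r) (s : ℂ) : Measurable fun x ↦ cpowAbove (t x) s (r x) :=
  Measurable.ite (measurableSet_lt ht hr) ((Complex.measurable_ofReal.comp hr).pow_const s)
    measurable_const

section InnerIntegral

variable {p : ℕ} [Fact p.Prime] [MeasurableSpace ℚ_[p]] [BorelSpace ℚ_[p]]
  {μ : Measure ℚ_[p]} [μ.IsAddHaarMeasure]

lemma Padic.integrable_radial_of_norm_le (hμ : μ {x : ℚ_[p] | ‖x‖ ≤ 1} = 1) {G : ℝ → ℂ}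
    (hG : Measurable G) (C : ℝ) (hC : ∀ r, 0 ≤ r → ‖G r‖ ≤ C * (max 1 r ^ 2)⁻¹) :
    Integrable (fun x : ℚ_[p] ↦ G ‖x‖) μ :=
  ((Padic.integrable_inv_max_one_norm_sq hμ).const_mul C).mono'
    (hG.comp measurable_norm).aestronglyMeasurable (.of_forall fun x ↦ hC _ (norm_nonneg x))

variable (μ) in
/-- The radial factor produced by integrating `|a + bx|ˢ θ(-x)` near the zero of `a + bx`. -/
noncomputable def Padic.nearZeroFactor (s : ℂ) (r : ℝ) : ℂ :=
  ∫ u in {u : ℚ_[p] | ‖u‖ ≤ 1}, cpowAbove 1 s (r * ‖u‖) ∂μ - cpowAbove 1 s (r * p)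

lemma Padic.IsStdChar.integral_affine_cpow {θ : ℚ_[p] → ℂ} (hθ : Padic.IsStdChar θ)
    (hμ : μ {x : ℚ_[p] | ‖x‖ ≤ 1} = 1) {s : ℂ} (hs : s.re ≤ -2) {a b : ℚ_[p]} (ha : p ≤ ‖a‖)
    (hb : b ≠ 0) (hab : ‖b‖ < ‖a‖) :
    ∫ x, cpowAbove ‖x‖ s ‖a + b * x‖ * θ (-x) ∂μ =
      (if ‖a‖ = p then (p : ℂ) ^ s else 0) +
        θ (a / b) * ((‖a / b‖ : ℂ) ^ s * Padic.nearZeroFactor μ s ‖b ^ 2 / a‖) := by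
  have hp1 : (1 : ℝ) < p := mod_cast (Fact.out : p.Prime).one_lt
  have ha0 : a ≠ 0 := by rintro rfl; rw [norm_zero] at ha; linarith
  have hb' : 0 < ‖b‖ := norm_pos_iff.2 hb
  set y := a / b with hy
  set w := b ^ 2 / a with hw
  have hby : b * y = a := mul_div_cancel₀ a hb
  have hyw : y * w = b := by rw [hy, hw]; field_simp
  have hnby : ‖b‖ * ‖y‖ = ‖a‖ := by rw [← norm_mul, hby]
  have hnyw : ‖y‖ * ‖w‖ = ‖b‖ := by rw [← norm_mul, hyw]
  have hy1 : 1 < ‖y‖ := by rwa [hy, norm_div, one_lt_div hb']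
  have hyp : (p : ℝ) ≤ ‖y‖ := (Padic.one_lt_norm_iff y).1 hy1
  have hy0 : 0 < ‖y‖ := by linarith
  set G₁ : ℝ → ℂ := fun r ↦ if r < ‖y‖ then (‖y‖ : ℂ) ^ s * cpowAbove 1 s (‖w‖ * r) else 0 with hG₁
  set G₂ : ℝ → ℂ := fun r ↦ cpowAbove r s (‖b‖ * max r ‖y‖) with hG₂
  set G₃ : ℝ → ℂ := fun r ↦ if r < ‖y‖ then cpowAbove ‖y‖ s ‖a‖ else 0 with hG₃
  have hG₁' (r : ℝ) (hr : 0 ≤ r) : G₁ r = if r < ‖y‖ then cpowAbove ‖y‖ s (‖b‖ * r) else 0 := by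
    have h := cpowAbove_mul hy0 (show 0 ≤ ‖w‖ * r by positivity) 1 s
    rw [mul_one] at h
    simp only [hG₁]
    rw [← hnyw, mul_assoc, h]
  have hsupp (r : ℝ) (hr : r < ‖y‖) : 1 ≤ ‖y‖ ^ 2 * (max 1 r ^ 2)⁻¹ := by
    have : 0 < max 1 r := by positivity
    rw [← div_eq_mul_inv, one_le_div (by positivity)]
    gcongr
    exact max_le hy1.le hr.le
  have i₁ : Integrable (fun x : ℚ_[p] ↦ G₁ ‖x‖) μ := by
    refine Padic.integrable_radial_of_norm_le hμ (Measurable.ite measurableSet_Iio (by fun_prop)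
      measurable_const) (‖y‖ ^ 2) fun r hr ↦ ?_
    rw [hG₁' r hr]
    split_ifs with h
    · exact (norm_cpowAbove_le_one hy1.le hs).trans (hsupp r h)
    · simp
  have i₃ : Integrable (fun x : ℚ_[p] ↦ G₃ ‖x‖) μ := by
    refine Padic.integrable_radial_of_norm_le hμ (Measurable.ite measurableSet_Iio (by fun_prop)
      measurable_const) (‖y‖ ^ 2) fun r hr ↦ ?_
    simp only [hG₃]
    split_ifs with h
    · exact (norm_cpowAbove_le_one hy1.le hs).trans (hsupp r h)
    · simp
  have i₂ : Integrable (fun x : ℚ_[p] ↦ G₂ ‖x‖) μ := by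
    refine Padic.integrable_radial_of_norm_le hμ (by fun_prop) ((‖b‖ ^ 2)⁻¹) fun r hr ↦ ?_
    simp only [hG₂, cpowAbove]
    have h1 : ‖a‖ ≤ ‖b‖ * max r ‖y‖ := by rw [← hnby]; gcongr; exact le_max_right _ _
    have h2 : 1 ≤ ‖b‖ * max r ‖y‖ := by linarith
    split_ifs with h
    · rw [Complex.norm_cpow_eq_rpow_re_of_pos (by linarith), ← mul_inv, ← mul_pow]
      calc (‖b‖ * max r ‖y‖) ^ s.re ≤ (‖b‖ * max r ‖y‖) ^ (-(2 : ℕ) : ℝ) :=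
            Real.rpow_le_rpow_of_exponent_le h2 (by simpa using hs)
        _ = ((‖b‖ * max r ‖y‖) ^ 2)⁻¹ := by
            rw [Real.rpow_neg (by linarith), Real.rpow_natCast]
        _ ≤ _ := by
            have : 0 < ‖b‖ * max 1 r := by positivity
            gcongr ((‖b‖ * ?_) ^ 2)⁻¹
            exact max_le (hy1.le.trans (le_max_right _ _)) (le_max_left _ _)
    · simp
  have hsplit (x : ℚ_[p]) : cpowAbove ‖x‖ s ‖a + b * x‖ * θ (-x) =
      θ y * (G₁ ‖x + y‖ * θ (-(x + y)) - G₃ ‖x + y‖ * θ (-(x + y))) + G₂ ‖x‖ * θ (-x) := by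
    have hθx : θ (-x) = θ y * θ (-(x + y)) := by rw [← hθ.map_add]; congr 1; ring
    have hnorm : ‖a + b * x‖ = ‖b‖ * ‖x + y‖ := by rw [← norm_mul, mul_add, hby, add_comm]
    rw [hθx, hG₁' _ (norm_nonneg _), hnorm]
    simp only [hG₂, hG₃]
    by_cases hu : ‖x + y‖ < ‖y‖
    · have hx : ‖x‖ = ‖y‖ := Padic.norm_eq_of_norm_add_lt_right hu
      simp only [hu, if_true, hx, max_self, hnby]
      ring
    · have hmax : max ‖x‖ ‖y‖ = ‖x + y‖ := by
        by_cases hne : ‖x‖ = ‖y‖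
        · refine le_antisymm ?_ (Padic.nonarchimedean x y)
          rw [hne, max_self]; exact not_lt.1 hu
        · exact (Padic.add_eq_max_of_ne hne).symm
      simp only [hu, if_false, hmax]
      ring
  have i₁θ := hθ.neg.integrable_mul i₁
  have i₂θ := hθ.neg.integrable_mul i₂
  have i₃θ := hθ.neg.integrable_mul i₃
  have e₁ : ∫ x in {x : ℚ_[p] | ‖x‖ ≤ 1}, G₁ ‖x‖ ∂μ =
      (‖y‖ : ℂ) ^ s * ∫ u in {u : ℚ_[p] | ‖u‖ ≤ 1}, cpowAbove 1 s (‖w‖ * ‖u‖) ∂μ := by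
    rw [← integral_const_mul]
    refine setIntegral_congr_fun (Padic.measurableSet_norm_le 1) fun x hx ↦ ?_
    exact if_pos (lt_of_le_of_lt hx hy1)
  have e₂ : ∫ x in {x : ℚ_[p] | ‖x‖ ≤ 1}, G₂ ‖x‖ ∂μ = (‖a‖ : ℂ) ^ s := by
    rw [setIntegral_congr_fun (g := fun _ ↦ (‖a‖ : ℂ) ^ s) (Padic.measurableSet_norm_le 1),
      setIntegral_const, measureReal_def, hμ]
    · simp
    · intro x (hx : ‖x‖ ≤ 1)
      simp only [hG₂, max_eq_right (hx.trans hy1.le), hnby]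
      exact if_pos (by linarith)
  have e₃ : ∫ x in {x : ℚ_[p] | ‖x‖ ≤ 1}, G₃ ‖x‖ ∂μ = cpowAbove ‖y‖ s ‖a‖ := by
    rw [setIntegral_congr_fun (g := fun _ ↦ cpowAbove ‖y‖ s ‖a‖) (Padic.measurableSet_norm_le 1),
      setIntegral_const, measureReal_def, hμ]
    · simp
    · exact fun x hx ↦ if_pos (lt_of_le_of_lt hx hy1)
  have e₂p : G₂ p = cpowAbove p s ‖a‖ := by simp only [hG₂, max_eq_right hyp, hnby]
  have hG₁₃ : -G₁ p - (cpowAbove ‖y‖ s ‖a‖ - G₃ p) =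
      - ((‖y‖ : ℂ) ^ s * cpowAbove 1 s (‖w‖ * p)) := by
    rcases hyp.lt_or_eq with h | h
    · simp only [hG₁, hG₃, if_pos h]; ring
    · rw [← cpowAbove_mul hy0 (by positivity), mul_one, ← mul_assoc, hnyw]
      simp only [hG₁, hG₃, h, lt_irrefl, if_false, hnby]
      ring
  simp only [hsplit]
  have j₁ : Integrable (fun x ↦ G₁ ‖x + y‖ * θ (-(x + y))) μ := i₁θ.comp_add_right y
  have j₃ : Integrable (fun x ↦ G₃ ‖x + y‖ * θ (-(x + y))) μ := i₃θ.comp_add_right y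
  have j : Integrable (fun x ↦ θ y * (G₁ ‖x + y‖ * θ (-(x + y)) - G₃ ‖x + y‖ * θ (-(x + y)))) μ :=
    (j₁.sub j₃).const_mul _
  rw [integral_add j i₂θ, integral_const_mul, integral_sub j₁ j₃,
    integral_add_right_eq_self (fun x ↦ G₁ ‖x‖ * θ (-x)),
    integral_add_right_eq_self (fun x ↦ G₃ ‖x‖ * θ (-x)),
    hθ.integral_radial_mul_neg hμ i₁, hθ.integral_radial_mul_neg hμ i₂,
    hθ.integral_radial_mul_neg hμ i₃, e₁, e₂, e₃, e₂p]
  have hfirst : (‖a‖ : ℂ) ^ s - cpowAbove p s ‖a‖ = if ‖a‖ = p then (p : ℂ) ^ s else 0 := by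
    unfold cpowAbove
    rcases ha.lt_or_eq with h | h
    · simp [h, h.ne']
    · simp [← h]
  rw [hfirst, Padic.nearZeroFactor]
  linear_combination θ y * hG₁₃

end InnerIntegral

section NearZeroFactor

variable {p : ℕ} [Fact p.Prime] [MeasurableSpace ℚ_[p]] {μ : Measure ℚ_[p]}

lemma Padic.norm_nearZeroFactor_le (hμ : μ {x : ℚ_[p] | ‖x‖ ≤ 1} = 1) {s : ℂ} (hs : s.re ≤ -2)
    (r : ℝ) : ‖Padic.nearZeroFactor μ s r‖ ≤ 2 := by
  have h := norm_setIntegral_le_of_norm_le_const (μ := μ) (s := {x : ℚ_[p] | ‖x‖ ≤ 1})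
    (by simp [hμ]) fun u _ ↦ norm_cpowAbove_le_one (r := r * ‖u‖) le_rfl hs
  rw [measureReal_def, hμ] at h
  calc _ ≤ _ := norm_sub_le _ _
    _ ≤ 1 + 1 := add_le_add (by simpa using h) (norm_cpowAbove_le_one le_rfl hs)
    _ = 2 := by norm_num

lemma Padic.nearZeroFactor_of_lt_one [BorelSpace ℚ_[p]] {w : ℚ_[p]} (hw : ‖w‖ < 1) (s : ℂ) :
    Padic.nearZeroFactor μ s ‖w‖ = 0 := by
  have h : ¬ 1 < ‖w‖ * p := by rw [mul_comm, Padic.one_lt_prime_mul_norm_iff]; exact not_le.2 hw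
  rw [Padic.nearZeroFactor, setIntegral_congr_fun (g := fun _ ↦ 0) (Padic.measurableSet_norm_le 1)]
  · simp [cpowAbove, h]
  · intro u (hu : ‖u‖ ≤ 1)
    exact if_neg (not_lt.2 (mul_le_one₀ hw.le (norm_nonneg u) hu))

lemma Padic.nearZeroFactor_one [BorelSpace ℚ_[p]] (s : ℂ) :
    Padic.nearZeroFactor μ s 1 = -(p : ℂ) ^ s := by
  have hp1 : (1 : ℝ) < p := mod_cast (Fact.out : p.Prime).one_lt
  rw [Padic.nearZeroFactor, setIntegral_congr_fun (g := fun _ ↦ 0) (Padic.measurableSet_norm_le 1)]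
  · simp [cpowAbove, hp1]
  · intro u (hu : ‖u‖ ≤ 1)
    exact if_neg (by simpa using hu)

end NearZeroFactor

section OuterIntegral

variable {p : ℕ} [Fact p.Prime] [MeasurableSpace ℚ_[p]] [BorelSpace ℚ_[p]]
  {μ : Measure ℚ_[p]} [μ.IsAddHaarMeasure]

lemma Padic.ae_ne_zero : ∀ᵐ x : ℚ_[p] ∂μ, x ≠ 0 :=
  compl_mem_ae_iff.2 (measure_singleton 0)

lemma Padic.measurable_nearZeroFactor (s : ℂ) : Measurable (Padic.nearZeroFactor μ s) := by
  have h : Measurable fun z : ℝ × ℚ_[p] ↦ cpowAbove 1 s (z.1 * ‖z.2‖) := by fun_prop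
  exact (h.stronglyMeasurable.integral_prod_right'
    (ν := μ.restrict {u : ℚ_[p] | ‖u‖ ≤ 1})).measurable.sub (by fun_prop)

lemma Padic.nearZeroFactor_prime (hμ : μ {x : ℚ_[p] | ‖x‖ ≤ 1} = 1) (s : ℂ) :
    Padic.nearZeroFactor μ s p = (1 - (p : ℂ)⁻¹) * (p : ℂ) ^ s - (p : ℂ) ^ s * (p : ℂ) ^ s := by
  have hp1 : (1 : ℝ) < p := mod_cast (Fact.out : p.Prime).one_lt
  rw [Padic.nearZeroFactor, ← Padic.setIntegral_unit_sphere hμ]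
  congr 1
  · refine setIntegral_congr_fun (Padic.measurableSet_norm_le 1) fun u (hu : ‖u‖ ≤ 1) ↦ ?_
    simp only [cpowAbove, Padic.one_lt_prime_mul_norm_iff]
    split_ifs with h
    · rw [le_antisymm hu h]; simp
    · rfl
  · rw [cpowAbove, if_pos (by nlinarith), Complex.ofReal_mul,
      Complex.mul_cpow_ofReal_nonneg (by linarith) (by linarith)]
    simp

lemma Padic.integrable_inv_norm_mul_mul (hμ : μ {x : ℚ_[p] | ‖x‖ ≤ 1} = 1) {Y W : ℚ_[p] → ℂ}
    (hYm : Measurable Y) (hWm : Measurable W) (hY : Integrable Y μ) (hW : Integrable W μ) :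
    Integrable (fun z : ℚ_[p] × ℚ_[p] ↦ (‖z.1‖⁻¹ : ℂ) * (Y z.1 * W (z.1⁻¹ * z.2)))
      (μ.prod μ) := by
  have hm : Measurable fun z : ℚ_[p] × ℚ_[p] ↦ (‖z.1‖⁻¹ : ℂ) * (Y z.1 * W (z.1⁻¹ * z.2)) := by
    fun_prop
  rw [integrable_prod_iff hm.aestronglyMeasurable]
  constructor
  · filter_upwards [Padic.ae_ne_zero (μ := μ)] with y hy
    exact ((Padic.integrable_comp_mul_left hμ (inv_ne_zero hy) hW).const_mul _).const_mul _
  · refine (hY.norm.mul_const (∫ x, ‖W x‖ ∂μ)).congr ?_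
    filter_upwards [Padic.ae_ne_zero (μ := μ)] with y hy
    have h := Padic.norm_smul_integral_comp_mul_left hμ (inv_ne_zero hy) fun x ↦ ‖W x‖
    simp only [norm_mul, integral_const_mul, ← h, norm_inv, smul_eq_mul, Complex.norm_real,
      norm_norm]
    ring

lemma Padic.integral_integral_inv_norm_mul_mul (hμ : μ {x : ℚ_[p] | ‖x‖ ≤ 1} = 1)
    {Y W : ℚ_[p] → ℂ} (hYm : Measurable Y) (hWm : Measurable W) (hY : Integrable Y μ)
    (hW : Integrable W μ) :
    ∫ b, ∫ y, (‖y‖⁻¹ : ℂ) * (Y y * W (y⁻¹ * b)) ∂μ ∂μ = (∫ y, Y y ∂μ) * ∫ w, W w ∂μ := by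
  have hi := Padic.integrable_inv_norm_mul_mul hμ hYm hWm hY hW
  rw [← integral_prod_symm _ hi, integral_prod _ hi, ← integral_mul_const]
  refine integral_congr_ae ?_
  filter_upwards [Padic.ae_ne_zero (μ := μ)] with y hy
  have h := Padic.norm_smul_integral_comp_mul_left hμ (inv_ne_zero hy) W
  simp only [integral_const_mul, ← h, norm_inv, Complex.real_smul, Complex.ofReal_inv]
  ring

lemma Padic.IsStdChar.integral_near_zero {θ : ℚ_[p] → ℂ} (hθ : Padic.IsStdChar θ)
    (hμ : μ {x : ℚ_[p] | ‖x‖ ≤ 1} = 1) {s ν : ℂ} (hs : s.re ≤ -2) (hν : 2 ≤ ν.re)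
    (hi : Integrable (fun z : ℚ_[p] × ℚ_[p] ↦ if p ≤ ‖z.1‖ ∧ ‖z.2‖ < ‖z.1‖ then
      (‖z.1‖ : ℂ) ^ (-1 - ν) * (θ (-(z.2 ^ 2 / z.1)) * (θ (z.1 / z.2) *
        ((‖z.1 / z.2‖ : ℂ) ^ s * Padic.nearZeroFactor μ s ‖z.2 ^ 2 / z.1‖))) else 0)
      (μ.prod μ)) :
    ∫ z : ℚ_[p] × ℚ_[p], (if p ≤ ‖z.1‖ ∧ ‖z.2‖ < ‖z.1‖ then
      (‖z.1‖ : ℂ) ^ (-1 - ν) * (θ (-(z.2 ^ 2 / z.1)) * (θ (z.1 / z.2) *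
        ((‖z.1 / z.2‖ : ℂ) ^ s * Padic.nearZeroFactor μ s ‖z.2 ^ 2 / z.1‖))) else 0)
      ∂(μ.prod μ) =
    (p : ℂ) ^ (s - 2 * ν) * ((1 - (p : ℂ)⁻¹) * (p : ℂ) ^ s +
      (p : ℂ) ^ (-ν) * ((1 - (p : ℂ)⁻¹) * (p : ℂ) ^ s - (p : ℂ) ^ s * (p : ℂ) ^ s)) := by
  have hp1 : (1 : ℝ) < p := mod_cast (Fact.out : p.Prime).one_lt
  set F : ℝ → ℂ := fun r ↦ if 1 ≤ r then (r : ℂ) ^ (-ν) * Padic.nearZeroFactor μ s r else 0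
    with hF
  set G : ℝ → ℂ := fun r ↦ cpowAbove 1 (s - 2 * ν) r with hG
  have hGm : Measurable G := by fun_prop
  have hFm : Measurable F := Measurable.ite measurableSet_Ici
    ((Complex.measurable_ofReal.pow_const _).mul (Padic.measurable_nearZeroFactor s))
    measurable_const
  have iG : Integrable (fun x : ℚ_[p] ↦ G ‖x‖) μ := by
    refine Padic.integrable_radial_of_norm_le hμ hGm 1 fun r _ ↦ ?_
    rw [one_mul]
    exact norm_cpowAbove_le le_rfl (by simp; linarith)
  have iF : Integrable (fun x : ℚ_[p] ↦ F ‖x‖) μ := by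
    refine Padic.integrable_radial_of_norm_le hμ hFm 2 fun r _ ↦ ?_
    simp only [hF]
    split_ifs with h
    · rw [norm_mul, mul_comm, Complex.norm_cpow_eq_rpow_re_of_pos (by linarith), max_eq_right h,
        ← Real.rpow_natCast, ← Real.rpow_neg (by linarith)]
      gcongr
      · exact Padic.norm_nearZeroFactor_le hμ hs r
      · simpa using hν
    · simp
  have eG : ∫ x, G ‖x‖ * θ x ∂μ = -(p : ℂ) ^ (s - 2 * ν) := by
    rw [hθ.integral_radial_mul hμ iG,
      setIntegral_congr_fun (g := fun _ ↦ 0) (Padic.measurableSet_norm_le 1)]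
    · simp [hG, cpowAbove, hp1]
    · exact fun x hx ↦ if_neg (not_lt.2 hx)
  have eF : ∫ x, F ‖x‖ * θ (-x) ∂μ = (1 - (p : ℂ)⁻¹) * (-(p : ℂ) ^ s) - (p : ℂ) ^ (-ν) *
      ((1 - (p : ℂ)⁻¹) * (p : ℂ) ^ s - (p : ℂ) ^ s * (p : ℂ) ^ s) := by
    rw [hθ.integral_radial_mul_neg hμ iF, ← Padic.setIntegral_unit_sphere hμ]
    congr 1
    · refine setIntegral_congr_fun (Padic.measurableSet_norm_le 1) fun x (hx : ‖x‖ ≤ 1) ↦ ?_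
      simp only [hF]
      split_ifs with h
      · rw [le_antisymm hx h, Padic.nearZeroFactor_one]; simp
      · rfl
    · simp only [hF, if_pos hp1.le, Padic.nearZeroFactor_prime hμ]
      simp
  have key : ∀ b : ℚ_[p], b ≠ 0 → ∀ y : ℚ_[p], (‖b‖ : ℂ) * (if p ≤ ‖b * y‖ ∧ ‖b‖ < ‖b * y‖ then
      (‖b * y‖ : ℂ) ^ (-1 - ν) * (θ (-(b ^ 2 / (b * y))) * (θ (b * y / b) *
        ((‖b * y / b‖ : ℂ) ^ s * Padic.nearZeroFactor μ s ‖b ^ 2 / (b * y)‖))) else 0) =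
      (‖y‖⁻¹ : ℂ) * ((G ‖y‖ * θ y) * (F ‖y⁻¹ * b‖ * θ (-(y⁻¹ * b)))) := by
    intro b hb y
    have hb' : 0 < ‖b‖ := norm_pos_iff.2 hb
    rcases eq_or_ne y 0 with rfl | hy
    · simp [(Fact.out : p.Prime).ne_zero]
    have hy' : 0 < ‖y‖ := norm_pos_iff.2 hy
    have h1 : b ^ 2 / (b * y) = y⁻¹ * b := by field_simp
    have h2 : b * y / b = y := by field_simp
    rw [h1, h2]
    obtain ⟨w, rfl⟩ : ∃ w, b = y * w := ⟨y⁻¹ * b, by field_simp⟩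
    rw [inv_mul_cancel_left₀ hy]
    have hw : w ≠ 0 := right_ne_zero_of_mul hb
    have hw' : 0 < ‖w‖ := norm_pos_iff.2 hw
    simp only [hG, cpowAbove, hF]
    by_cases hy1 : 1 < ‖y‖
    · by_cases hw1 : 1 ≤ ‖w‖
      · have hyp := (Padic.one_lt_norm_iff y).1 hy1
        have hn : ‖y * w * y‖ = ‖y‖ * ‖y‖ * ‖w‖ := by simp only [norm_mul]; ring
        have hc : p ≤ ‖y * w * y‖ ∧ ‖y * w‖ < ‖y * w * y‖ := by
          constructor
          · rw [hn]
            calc (p : ℝ) = p * 1 * 1 := by ring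
              _ ≤ _ := by gcongr
          · rw [norm_mul _ y]
            exact lt_mul_of_one_lt_right hb' hy1
        have hyc : (‖y‖ : ℂ) ≠ 0 := mod_cast hy'.ne'
        have hwc : (‖w‖ : ℂ) ≠ 0 := mod_cast hw'.ne'
        have e1 : (‖y * w * y‖ : ℂ) ^ (-1 - ν) =
            (‖y‖ : ℂ)⁻¹ * (‖y‖ : ℂ)⁻¹ * ((‖y‖ : ℂ) ^ (-ν) * (‖y‖ : ℂ) ^ (-ν)) *
              ((‖w‖ : ℂ)⁻¹ * (‖w‖ : ℂ) ^ (-ν)) := by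
          rw [hn, Complex.ofReal_mul,
            Complex.mul_cpow_ofReal_nonneg (mul_nonneg hy'.le hy'.le) hw'.le, Complex.ofReal_mul,
            Complex.mul_cpow_ofReal_nonneg hy'.le hy'.le, sub_eq_add_neg,
            Complex.cpow_add _ _ hyc, Complex.cpow_add _ _ hwc, Complex.cpow_neg_one,
            Complex.cpow_neg_one]
          ring
        have e2 : (‖y‖ : ℂ) ^ (s - 2 * ν) =
            (‖y‖ : ℂ) ^ s * ((‖y‖ : ℂ) ^ (-ν) * (‖y‖ : ℂ) ^ (-ν)) := by
          rw [← Complex.cpow_add _ _ hyc, ← Complex.cpow_add _ _ hyc]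
          congr 1; ring
        rw [if_pos hc, if_pos hy1, if_pos hw1, e1, e2, norm_mul, Complex.ofReal_mul]
        field_simp
      · simp [hw1, Padic.nearZeroFactor_of_lt_one (not_le.1 hw1)]
    · have : ¬ ‖y * w‖ < ‖y * w * y‖ := by
        rw [norm_mul _ y, not_lt]
        exact mul_le_of_le_one_right hb'.le (not_lt.1 hy1)
      rw [if_neg (fun h ↦ this h.2), if_neg hy1]
      simp
  rw [integral_prod_symm _ hi]
  have hb (b : ℚ_[p]) (hb : b ≠ 0) : (∫ a, (if p ≤ ‖a‖ ∧ ‖b‖ < ‖a‖ then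
      (‖a‖ : ℂ) ^ (-1 - ν) * (θ (-(b ^ 2 / a)) * (θ (a / b) *
        ((‖a / b‖ : ℂ) ^ s * Padic.nearZeroFactor μ s ‖b ^ 2 / a‖))) else 0) ∂μ) =
      ∫ y, (‖y‖⁻¹ : ℂ) * ((G ‖y‖ * θ y) * (F ‖y⁻¹ * b‖ * θ (-(y⁻¹ * b)))) ∂μ := by
    rw [← Padic.norm_smul_integral_comp_mul_left hμ hb, Complex.real_smul, ← integral_const_mul]
    simp only [key b hb]
  rw [integral_congr_ae (Padic.ae_ne_zero.mono hb), Padic.integral_integral_inv_norm_mul_mul hμ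
    (Y := fun y ↦ G ‖y‖ * θ y) (W := fun w ↦ F ‖w‖ * θ (-w))
    ((hGm.comp measurable_norm).mul hθ.measurable)
    ((hFm.comp measurable_norm).mul hθ.neg.measurable)
    (hθ.integrable_mul iG) (hθ.neg.integrable_mul iF), eG, eF]
  ring

lemma Padic.integral_sphere_prod_ball (hμ : μ {x : ℚ_[p] | ‖x‖ ≤ 1} = 1) (c : ℂ) :
    ∫ z : ℚ_[p] × ℚ_[p], (if ‖z.1‖ = p ∧ ‖z.2‖ ≤ 1 then c else 0) ∂(μ.prod μ) = (p - 1) * c := by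
  have hp1 : (1 : ℝ) < p := mod_cast (Fact.out : p.Prime).one_lt
  have h1 : ∫ x : ℚ_[p], (if ‖x‖ ≤ 1 then (1 : ℂ) else 0) ∂μ = 1 := by
    have := integral_indicator_const (μ := μ) (1 : ℂ) (Padic.measurableSet_norm_le (p := p) 1)
    rw [measureReal_def, hμ] at this
    simpa [Set.indicator] using this
  have hball : MeasurableSet {x : ℚ_[p] | ‖x‖ ≤ (p : ℝ) ^ (1 : ℤ)} := Padic.measurableSet_norm_le _
  have h2 : ∫ x : ℚ_[p], (if ‖x‖ = p then c else 0) ∂μ = (p - 1) * c := by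
    have hf : (fun x : ℚ_[p] ↦ if ‖x‖ = p then c else 0) = fun x ↦
        {x : ℚ_[p] | ‖x‖ ≤ (p : ℝ) ^ (1 : ℤ)}.indicator (fun _ ↦ c) x -
        {x : ℚ_[p] | ‖x‖ ≤ 1}.indicator (fun _ ↦ c) x := by
      ext x
      have := Padic.one_lt_norm_iff x
      simp only [Set.indicator, Set.mem_ofPred_eq, zpow_one]
      split_ifs <;> grind
    rw [hf,
      integral_sub (Padic.integrable_indicator_ball _ _) (Padic.integrable_indicator_ball _ _),
      integral_indicator_const _ hball, integral_indicator_const _ (Padic.measurableSet_norm_le 1),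
      Padic.measureReal_ball hμ, measureReal_def, hμ]
    simp [sub_mul]
  have := integral_prod_mul (μ := μ) (ν := μ) (fun x : ℚ_[p] ↦ if ‖x‖ = p then c else 0)
    (fun x : ℚ_[p] ↦ if ‖x‖ ≤ 1 then (1 : ℂ) else 0)
  rw [h1, h2, mul_one] at this
  rw [← this]
  congr 1
  ext z
  split_ifs <;> simp_all

end OuterIntegral

section Region

variable {p : ℕ} [Fact p.Prime]

lemma Padic.addValuation_le_addValuation_iff (x y : ℚ_[p]) :
    Padic.addValuation x ≤ Padic.addValuation y ↔ ‖y‖ ≤ ‖x‖ := by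
  have hp1 : (1 : ℝ) < p := mod_cast (Fact.out : p.Prime).one_lt
  rcases eq_or_ne y 0 with rfl | hy
  · simp
  rcases eq_or_ne x 0 with rfl | hx
  · simp [hy]
  rw [Padic.addValuation.apply hx, Padic.addValuation.apply hy, WithTop.coe_le_coe,
    Padic.norm_eq_zpow_neg_valuation hx, Padic.norm_eq_zpow_neg_valuation hy,
    zpow_le_zpow_iff_right₀ hp1, neg_le_neg_iff]

lemma Padic.addValuation_le_neg_one_iff (x : ℚ_[p]) :
    Padic.addValuation x ≤ ((-1 : ℤ) : WithTop ℤ) ↔ p ≤ ‖x‖ := by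
  have hp : (p : ℚ_[p]) ≠ 0 := mod_cast (Fact.out : p.Prime).ne_zero
  have h : Padic.addValuation (p : ℚ_[p])⁻¹ = ((-1 : ℤ) : WithTop ℤ) := by
    rw [Padic.addValuation.apply (inv_ne_zero hp)]
    simp
  rw [← h, Padic.addValuation_le_addValuation_iff]
  simp

lemma Padic.addValuation_le_sub_one_iff {x : ℚ_[p]} (hx : x ≠ 0) (y : ℚ_[p]) :
    Padic.addValuation x ≤ Padic.addValuation y - 1 ↔ ‖y‖ < ‖x‖ := by
  have hp1 : (1 : ℝ) < p := mod_cast (Fact.out : p.Prime).one_lt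
  rcases eq_or_ne y 0 with rfl | hy
  · have : (⊤ : WithTop ℤ) - 1 = ⊤ := rfl
    simp [this, hx]
  have h : (y.valuation : WithTop ℤ) - 1 = ((y.valuation - 1 : ℤ) : WithTop ℤ) := rfl
  rw [Padic.addValuation.apply hx, Padic.addValuation.apply hy, h, WithTop.coe_le_coe,
    Padic.norm_eq_zpow_neg_valuation hx, Padic.norm_eq_zpow_neg_valuation hy,
    zpow_lt_zpow_iff_right₀ hp1]
  omega

lemma Padic.mem_region_iff (a b c x : ℚ_[p]) :
    (Padic.addValuation a ≤ min ((-1 : ℤ) : WithTop ℤ)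
        (min (Padic.addValuation b - 1) (Padic.addValuation (a * c - b ^ 2))) ∧
      Padic.addValuation (a + b * x) < Padic.addValuation x) ↔
    (p ≤ ‖a‖ ∧ ‖b‖ < ‖a‖) ∧ ‖a * c - b ^ 2‖ ≤ ‖a‖ ∧ ‖x‖ < ‖a + b * x‖ := by
  have hp0 : (0 : ℝ) < p := mod_cast (Fact.out : p.Prime).pos
  rw [le_min_iff, le_min_iff, Padic.addValuation_le_neg_one_iff,
    Padic.addValuation_le_addValuation_iff, ← not_le, Padic.addValuation_le_addValuation_iff,
    not_le]
  rcases eq_or_ne a 0 with rfl | ha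
  · simp [hp0.not_ge]
  · rw [Padic.addValuation_le_sub_one_iff ha]
    tauto

lemma Padic.one_lt_norm_add_mul {a b x : ℚ_[p]} (ha : 1 < ‖a‖) (hb : ‖b‖ < ‖a‖)
    (hx : ‖x‖ < ‖a + b * x‖) : 1 < ‖a + b * x‖ := by
  by_contra! h
  have hx1 : ‖x‖ < 1 := hx.trans_le h
  have h1 : ‖b * x‖ < ‖a‖ := by
    rw [norm_mul]
    exact (mul_le_of_le_one_right (norm_nonneg b) hx1.le).trans_lt hb
  rw [add_comm, Padic.norm_add_eq_of_lt h1] at h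
  linarith

lemma Padic.norm_le_of_norm_mul_sub_sq_le {a b c : ℚ_[p]} (ha : 1 < ‖a‖) (hb : ‖b‖ < ‖a‖)
    (hc : ‖a * c - b ^ 2‖ ≤ ‖a‖) : ‖c‖ ≤ ‖a‖ := by
  have h : ‖a‖ * ‖c‖ ≤ ‖a‖ * ‖a‖ := by
    calc ‖a‖ * ‖c‖ = ‖(a * c - b ^ 2) + b ^ 2‖ := by rw [sub_add_cancel, norm_mul]
      _ ≤ max ‖a * c - b ^ 2‖ ‖b ^ 2‖ := Padic.nonarchimedean _ _
      _ ≤ ‖a‖ * ‖a‖ := by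
        refine max_le (hc.trans (le_mul_of_one_le_left (norm_nonneg a) ha.le)) ?_
        rw [norm_pow, sq]
        gcongr
  exact le_of_mul_le_mul_left h (by linarith)

/-- The integrand extended by zero, as a product over which the integrals in `c` and `x`
factor. -/
noncomputable def Padic.regionIntegrand (θ : ℚ_[p] → ℂ) (s ν : ℂ) (a b c x : ℚ_[p]) : ℂ :=
  (if p ≤ ‖a‖ ∧ ‖b‖ < ‖a‖ then (‖a‖ : ℂ) ^ (-1 - ν) else 0) *
    (((if ‖a * c - b ^ 2‖ ≤ ‖a‖ then 1 else 0) * θ (-c)) *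
      (cpowAbove ‖x‖ s ‖a + b * x‖ * θ (-x)))

lemma Padic.IsStdChar.norm_regionIntegrand_le {θ : ℚ_[p] → ℂ} (hθ : Padic.IsStdChar θ) {s ν : ℂ}
    (hs : s.re ≤ -2) (hν : 5 ≤ ν.re) (a b c x : ℚ_[p]) :
    ‖Padic.regionIntegrand θ s ν a b c x‖ ≤ (max 1 ‖a‖ ^ 2)⁻¹ * ((max 1 ‖b‖ ^ 2)⁻¹ *
      ((max 1 ‖c‖ ^ 2)⁻¹ * (max 1 ‖x‖ ^ 2)⁻¹)) := by
  have hp1 : (1 : ℝ) < p := mod_cast (Fact.out : p.Prime).one_lt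
  by_cases h : (p ≤ ‖a‖ ∧ ‖b‖ < ‖a‖) ∧ ‖a * c - b ^ 2‖ ≤ ‖a‖ ∧ ‖x‖ < ‖a + b * x‖
  · obtain ⟨⟨ha, hb⟩, hc, hx⟩ := h
    have ha1 : 1 < ‖a‖ := hp1.trans_le ha
    have hc' := Padic.norm_le_of_norm_mul_sub_sq_le ha1 hb hc
    have hx1 := Padic.one_lt_norm_add_mul ha1 hb hx
    have e1 : ‖(‖a‖ : ℂ) ^ (-1 - ν)‖ ≤ (‖a‖ ^ 2)⁻¹ * ((‖a‖ ^ 2)⁻¹ * (‖a‖ ^ 2)⁻¹) := by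
      rw [Complex.norm_cpow_eq_rpow_re_of_pos (by linarith)]
      calc ‖a‖ ^ (-1 - ν).re ≤ ‖a‖ ^ (-(6 : ℕ) : ℝ) :=
            Real.rpow_le_rpow_of_exponent_le ha1.le (by simp; linarith)
        _ = _ := by rw [Real.rpow_neg (by linarith), Real.rpow_natCast, ← mul_inv, ← mul_inv]; ring
    have e2 : ‖cpowAbove ‖x‖ s ‖a + b * x‖‖ ≤ (max 1 ‖x‖ ^ 2)⁻¹ := by
      have : cpowAbove ‖x‖ s ‖a + b * x‖ = cpowAbove 1 s ‖a + b * x‖ := by simp [cpowAbove, hx, hx1]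
      rw [this]
      refine (norm_cpowAbove_le le_rfl hs).trans ?_
      gcongr
    rw [Padic.regionIntegrand, if_pos ⟨ha, hb⟩, if_pos hc]
    simp only [norm_mul, hθ.norm_eq_one, one_mul, mul_one]
    calc _ ≤ ((‖a‖ ^ 2)⁻¹ * ((‖a‖ ^ 2)⁻¹ * (‖a‖ ^ 2)⁻¹)) * (max 1 ‖x‖ ^ 2)⁻¹ := by gcongr
      _ = (‖a‖ ^ 2)⁻¹ * ((‖a‖ ^ 2)⁻¹ * ((‖a‖ ^ 2)⁻¹ * (max 1 ‖x‖ ^ 2)⁻¹)) := by ring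
      _ ≤ _ := by
        have h1 : max 1 ‖a‖ ≤ ‖a‖ := max_le ha1.le le_rfl
        have h2 : max 1 ‖b‖ ≤ ‖a‖ := max_le ha1.le hb.le
        have h3 : max 1 ‖c‖ ≤ ‖a‖ := max_le ha1.le hc'
        gcongr
  · have h0 : Padic.regionIntegrand θ s ν a b c x = 0 := by
      simp only [Padic.regionIntegrand, cpowAbove]
      split_ifs <;> simp_all
    rw [h0, norm_zero]
    positivity

end Region

section MainIntegral

variable {p : ℕ} [Fact p.Prime] [MeasurableSpace ℚ_[p]] [BorelSpace ℚ_[p]]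
  {μ : Measure ℚ_[p]} [μ.IsAddHaarMeasure]

lemma Padic.IsStdChar.integral_congruence {θ : ℚ_[p] → ℂ} (hθ : Padic.IsStdChar θ)
    (hμ : μ {x : ℚ_[p] | ‖x‖ ≤ 1} = 1) {a : ℚ_[p]} (ha : a ≠ 0) (b : ℚ_[p]) :
    ∫ c, (if ‖a * c - b ^ 2‖ ≤ ‖a‖ then 1 else 0) * θ (-c) ∂μ = θ (-(b ^ 2 / a)) := by
  have ha' : 0 < ‖a‖ := norm_pos_iff.2 ha
  have h (c : ℚ_[p]) : (if ‖a * (c + b ^ 2 / a) - b ^ 2‖ ≤ ‖a‖ then 1 else 0) *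
      θ (-(c + b ^ 2 / a)) = {x : ℚ_[p] | ‖x‖ ≤ 1}.indicator (fun _ ↦ θ (-(b ^ 2 / a))) c := by
    have h1 : a * (c + b ^ 2 / a) - b ^ 2 = a * c := by field_simp; ring
    have h2 : ‖a * c‖ ≤ ‖a‖ ↔ ‖c‖ ≤ 1 := by rw [norm_mul, mul_le_iff_le_one_right ha']
    simp only [h1, h2, Set.indicator, Set.mem_ofPred_eq]
    split_ifs with hc
    · rw [neg_add, hθ.map_add, hθ.eq_one _ (by rwa [norm_neg])]; simp
    · simp
  rw [← integral_add_right_eq_self _ (b ^ 2 / a)]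
  simp only [h]
  rw [integral_indicator_const _ (Padic.measurableSet_norm_le 1), measureReal_def, hμ]
  simp

lemma Padic.integrable_sphere_prod_ball (c : ℂ) :
    Integrable (fun z : ℚ_[p] × ℚ_[p] ↦ if ‖z.1‖ = p ∧ ‖z.2‖ ≤ 1 then c else 0) (μ.prod μ) := by
  refine ((Padic.integrable_indicator_ball (μ := μ) p c).mul_prod
    (Padic.integrable_indicator_ball (μ := μ) 1 1)).mono ?_ (.of_forall fun z ↦ ?_)
  · refine (Measurable.ite ?_ measurable_const measurable_const).aestronglyMeasurable
    have h1 : MeasurableSet {z : ℚ_[p] × ℚ_[p] | ‖z.1‖ = p} :=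
      measurableSet_eq_fun (by fun_prop) (by fun_prop)
    have h2 : MeasurableSet {z : ℚ_[p] × ℚ_[p] | ‖z.2‖ ≤ 1} :=
      measurableSet_le (by fun_prop) (by fun_prop)
    exact h1.inter h2
  · by_cases h : ‖z.1‖ = p ∧ ‖z.2‖ ≤ 1
    · simp [h]
    · rw [if_neg h, norm_zero]
      positivity

lemma Padic.measurableSet_norm_lt_norm_fst : MeasurableSet
    {q : ℚ_[p] × ℚ_[p] × ℚ_[p] × ℚ_[p] | p ≤ ‖q.1‖ ∧ ‖q.2.1‖ < ‖q.1‖} := by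
  have h1 : MeasurableSet {q : ℚ_[p] × ℚ_[p] × ℚ_[p] × ℚ_[p] | p ≤ ‖q.1‖} :=
    measurableSet_le (by fun_prop) (by fun_prop)
  have h2 : MeasurableSet {q : ℚ_[p] × ℚ_[p] × ℚ_[p] × ℚ_[p] | ‖q.2.1‖ < ‖q.1‖} :=
    measurableSet_lt (by fun_prop) (by fun_prop)
  exact h1.inter h2

lemma Padic.measurableSet_region : MeasurableSet {q : ℚ_[p] × ℚ_[p] × ℚ_[p] × ℚ_[p] |
    (p ≤ ‖q.1‖ ∧ ‖q.2.1‖ < ‖q.1‖) ∧ ‖q.1 * q.2.2.1 - q.2.1 ^ 2‖ ≤ ‖q.1‖ ∧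
      ‖q.2.2.2‖ < ‖q.1 + q.2.1 * q.2.2.2‖} := by
  have h1 : MeasurableSet {q : ℚ_[p] × ℚ_[p] × ℚ_[p] × ℚ_[p] |
      ‖q.1 * q.2.2.1 - q.2.1 ^ 2‖ ≤ ‖q.1‖} := measurableSet_le (by fun_prop) (by fun_prop)
  have h2 : MeasurableSet {q : ℚ_[p] × ℚ_[p] × ℚ_[p] × ℚ_[p] |
      ‖q.2.2.2‖ < ‖q.1 + q.2.1 * q.2.2.2‖} := measurableSet_lt (by fun_prop) (by fun_prop)
  exact Padic.measurableSet_norm_lt_norm_fst.inter (h1.inter h2)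


lemma Padic.IsStdChar.integrable_regionIntegrand {θ : ℚ_[p] → ℂ} (hθ : Padic.IsStdChar θ)
    (hμ : μ {x : ℚ_[p] | ‖x‖ ≤ 1} = 1) {s ν : ℂ} (hs : s.re ≤ -2) (hν : 5 ≤ ν.re) :
    Integrable (fun q : ℚ_[p] × ℚ_[p] × ℚ_[p] × ℚ_[p] ↦
      Padic.regionIntegrand θ s ν q.1 q.2.1 q.2.2.1 q.2.2.2) (μ.prod (μ.prod (μ.prod μ))) := by
  have hM := Padic.integrable_inv_max_one_norm_sq hμ
  refine (hM.mul_prod (hM.mul_prod (hM.mul_prod hM))).mono' ?_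
    (.of_forall fun q ↦ hθ.norm_regionIntegrand_le hs hν _ _ _ _)
  have hθm := hθ.measurable
  have m1 : Measurable fun q : ℚ_[p] × ℚ_[p] × ℚ_[p] × ℚ_[p] ↦
      if p ≤ ‖q.1‖ ∧ ‖q.2.1‖ < ‖q.1‖ then (‖q.1‖ : ℂ) ^ (-1 - ν) else 0 :=
    Measurable.ite Padic.measurableSet_norm_lt_norm_fst (by fun_prop) measurable_const
  have m2 : Measurable fun q : ℚ_[p] × ℚ_[p] × ℚ_[p] × ℚ_[p] ↦
      if ‖q.1 * q.2.2.1 - q.2.1 ^ 2‖ ≤ ‖q.1‖ then (1 : ℂ) else 0 :=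
    Measurable.ite (measurableSet_le (by fun_prop) (by fun_prop)) measurable_const measurable_const
  exact (m1.mul ((m2.mul (by fun_prop)).mul (by fun_prop))).aestronglyMeasurable

lemma Padic.IsStdChar.integral_regionIntegrand {θ : ℚ_[p] → ℂ} (hθ : Padic.IsStdChar θ)
    (hμ : μ {x : ℚ_[p] | ‖x‖ ≤ 1} = 1) {s ν : ℂ} (hs : s.re ≤ -2) (hν : 5 ≤ ν.re) :
    ∫ q : ℚ_[p] × ℚ_[p] × ℚ_[p] × ℚ_[p], Padic.regionIntegrand θ s ν q.1 q.2.1 q.2.2.1 q.2.2.2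
      ∂(μ.prod (μ.prod (μ.prod μ))) =
    (p - 1) * ((p : ℂ) ^ (-1 - ν) * (p : ℂ) ^ s) +
    (p : ℂ) ^ (s - 2 * ν) * ((1 - (p : ℂ)⁻¹) * (p : ℂ) ^ s +
      (p : ℂ) ^ (-ν) * ((1 - (p : ℂ)⁻¹) * (p : ℂ) ^ s - (p : ℂ) ^ s * (p : ℂ) ^ s)) := by
  have hp1 : (1 : ℝ) < p := mod_cast (Fact.out : p.Prime).one_lt
  have hmp := measurePreserving_prodAssoc μ μ (μ.prod μ)
  have hi : Integrable (fun z : (ℚ_[p] × ℚ_[p]) × (ℚ_[p] × ℚ_[p]) ↦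
      Padic.regionIntegrand θ s ν z.1.1 z.1.2 z.2.1 z.2.2) ((μ.prod μ).prod (μ.prod μ)) :=
    (hmp.integrable_comp_emb MeasurableEquiv.prodAssoc.measurableEmbedding).2
      (hθ.integrable_regionIntegrand hμ hs hν)
  have hswap := hmp.integral_comp MeasurableEquiv.prodAssoc.measurableEmbedding
    fun q : ℚ_[p] × ℚ_[p] × ℚ_[p] × ℚ_[p] ↦ Padic.regionIntegrand θ s ν q.1 q.2.1 q.2.2.1 q.2.2.2
  have hae : ∀ᵐ z : ℚ_[p] × ℚ_[p] ∂(μ.prod μ), ∫ u : ℚ_[p] × ℚ_[p],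
      Padic.regionIntegrand θ s ν z.1 z.2 u.1 u.2 ∂(μ.prod μ) =
      (if ‖z.1‖ = p ∧ ‖z.2‖ ≤ 1 then (p : ℂ) ^ (-1 - ν) * (p : ℂ) ^ s else 0) +
      if p ≤ ‖z.1‖ ∧ ‖z.2‖ < ‖z.1‖ then
        (‖z.1‖ : ℂ) ^ (-1 - ν) * (θ (-(z.2 ^ 2 / z.1)) * (θ (z.1 / z.2) *
          ((‖z.1 / z.2‖ : ℂ) ^ s * Padic.nearZeroFactor μ s ‖z.2 ^ 2 / z.1‖))) else 0 := by
    filter_upwards [Measure.quasiMeasurePreserving_snd.ae (Padic.ae_ne_zero (μ := μ))]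
      with ⟨a, b⟩ (hb : b ≠ 0)
    simp only [Padic.regionIntegrand]
    rw [integral_const_mul, integral_prod_mul (fun c ↦
      (if ‖a * c - b ^ 2‖ ≤ ‖a‖ then (1 : ℂ) else 0) * θ (-c))
      (fun x ↦ cpowAbove ‖x‖ s ‖a + b * x‖ * θ (-x))]
    by_cases h : p ≤ ‖a‖ ∧ ‖b‖ < ‖a‖
    · have ha : a ≠ 0 := norm_pos_iff.1 (by linarith [h.1])
      rw [hθ.integral_congruence hμ ha, hθ.integral_affine_cpow hμ hs h.1 hb h.2, if_pos h,
        if_pos h]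
      by_cases hap : ‖a‖ = p
      · have hb1 : ‖b‖ ≤ 1 := (Padic.norm_le_one_iff_lt_prime b).2 (hap ▸ h.2)
        have hw : ‖-(b ^ 2 / a)‖ ≤ 1 := by
          rw [norm_neg, norm_div, norm_pow, hap]
          exact div_le_one_of_le₀ ((pow_le_one₀ (norm_nonneg b) hb1).trans hp1.le) (by linarith)
        rw [if_pos hap, if_pos ⟨hap, hb1⟩, hθ.eq_one _ hw, hap]
        push_cast
        ring
      · rw [if_neg hap, if_neg (fun h ↦ hap h.1), zero_add, zero_add]
    · have h' : ¬ (‖a‖ = p ∧ ‖b‖ ≤ 1) := fun h' ↦ h ⟨h'.1.ge, by linarith [h'.1, h'.2]⟩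
      rw [if_neg h, if_neg h, if_neg h', zero_mul, zero_add]
  have iP := Padic.integrable_sphere_prod_ball (μ := μ) ((p : ℂ) ^ (-1 - ν) * (p : ℂ) ^ s)
  have iQ := (hi.integral_prod_left.sub iP).congr (hae.mono fun z hz ↦ by
    rw [Pi.sub_apply, hz, add_sub_cancel_left])
  rw [← hswap]
  refine (integral_prod _ hi).trans ?_
  rw [integral_congr_ae hae, integral_add iP iQ, Padic.integral_sphere_prod_ball hμ,
    hθ.integral_near_zero hμ hs (by linarith) iQ]

end MainIntegral

lemma Padic.isAddHaarMeasure_of_map_add_left {p : ℕ} [Fact p.Prime] [MeasurableSpace ℚ_[p]]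
    [BorelSpace ℚ_[p]] {μ : Measure ℚ_[p]} (h : ∀ a : ℚ_[p], μ.map (a + ·) = μ)
    (hμ : μ {x : ℚ_[p] | ‖x‖ ≤ 1} = 1) : μ.IsAddHaarMeasure := by
  have : μ.IsAddLeftInvariant := ⟨h⟩
  have hK : {x : ℚ_[p] | ‖x‖ ≤ 1} = Metric.closedBall 0 1 := by ext; simp
  rw [hK] at hμ
  refine Measure.isAddHaarMeasure_of_isCompact_nonempty_interior μ (Metric.closedBall 0 1)
    (isCompact_closedBall 0 1) ⟨0, ?_⟩ (by simp [hμ]) (by simp [hμ])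
  exact Metric.ball_subset_interior_closedBall (Metric.mem_ball_self one_pos)

/-- For `Re(ν₂)` and `Re(ν₁−ν₂)` large enough, with `(a,b,c,x) = q`,
the function `|a+bx|^{−1−ν₁+ν₂}·|a|^{−1−ν₂}·θ(−x−c)` is absolutely integrable on
`R = {v(a) ≤ min{−1, v(b)−1, v(ac−b²)}, v(a+bx) < v(x)}` and its integral equals
`(1−p⁻¹)p^{−1−ν₁} + (1−p⁻¹)p^{−2−2ν₁} + (1−p⁻¹)p^{−2−2ν₁−ν₂} − p^{−3−3ν₁}`. -/
theorem stmt_17 (p : ℕ) [Fact p.Prime]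
    [MeasurableSpace ℚ_[p]] [BorelSpace ℚ_[p]]
    (μ : Measure ℚ_[p]) [SigmaFinite μ]
    (hμ_inv : ∀ a : ℚ_[p], μ.map (a + ·) = μ)
    (hμ_norm : μ {x : ℚ_[p] | ‖x‖ ≤ 1} = 1)
    (θ : ℚ_[p] → ℂ) (hθ_cont : Continuous θ)
    (hθ_add : ∀ a b : ℚ_[p], θ (a + b) = θ a * θ b)
    (hθ_unit : ∀ a : ℚ_[p], ‖θ a‖ = 1)
    (hθ_triv : ∀ a : ℚ_[p], ‖a‖ ≤ 1 → θ a = 1)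
    (hθ_nontriv : ∃ a : ℚ_[p], ‖a‖ ≤ (p : ℝ) ∧ θ a ≠ 1) :
    ∃ T : ℝ, ∀ ν₁ ν₂ : ℂ, T < ν₂.re → T < (ν₁ - ν₂).re →
      IntegrableOn
        (fun q : ℚ_[p] × ℚ_[p] × ℚ_[p] × ℚ_[p] =>
          (‖q.1 + q.2.1 * q.2.2.2‖ : ℂ) ^ (-1 - ν₁ + ν₂) *
            (‖q.1‖ : ℂ) ^ (-1 - ν₂) * θ (-q.2.2.2 - q.2.2.1))
        {q : ℚ_[p] × ℚ_[p] × ℚ_[p] × ℚ_[p] | Padic.addValuation q.1 ≤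
            min ((-1 : ℤ) : WithTop ℤ)
              (min (Padic.addValuation q.2.1 - 1)
                (Padic.addValuation (q.1 * q.2.2.1 - q.2.1 ^ 2))) ∧
          Padic.addValuation (q.1 + q.2.1 * q.2.2.2) < Padic.addValuation q.2.2.2}
        (μ.prod (μ.prod (μ.prod μ))) ∧
      ∫ q in {q : ℚ_[p] × ℚ_[p] × ℚ_[p] × ℚ_[p] | Padic.addValuation q.1 ≤
            min ((-1 : ℤ) : WithTop ℤ)
              (min (Padic.addValuation q.2.1 - 1)
                (Padic.addValuation (q.1 * q.2.2.1 - q.2.1 ^ 2))) ∧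
          Padic.addValuation (q.1 + q.2.1 * q.2.2.2) < Padic.addValuation q.2.2.2},
          (‖q.1 + q.2.1 * q.2.2.2‖ : ℂ) ^ (-1 - ν₁ + ν₂) *
            (‖q.1‖ : ℂ) ^ (-1 - ν₂) * θ (-q.2.2.2 - q.2.2.1)
          ∂(μ.prod (μ.prod (μ.prod μ))) =
        (1 - (p : ℂ)⁻¹) * (p : ℂ) ^ (-1 - ν₁) +
          (1 - (p : ℂ)⁻¹) * (p : ℂ) ^ (-2 - 2 * ν₁) +
          (1 - (p : ℂ)⁻¹) * (p : ℂ) ^ (-2 - 2 * ν₁ - ν₂) -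
          (p : ℂ) ^ (-3 - 3 * ν₁) := by
  have := Padic.isAddHaarMeasure_of_map_add_left hμ_inv hμ_norm
  have hθ : Padic.IsStdChar θ := ⟨hθ_cont, hθ_add, hθ_unit, hθ_triv, hθ_nontriv⟩
  refine ⟨5, fun ν₁ ν₂ h₂ h₁₂ ↦ ?_⟩
  have hs : (-1 - ν₁ + ν₂).re ≤ -2 := by
    simp only [Complex.sub_re, Complex.add_re, Complex.neg_re, Complex.one_re] at h₁₂ ⊢
    linarith
  simp only [Padic.mem_region_iff]
  have hR := Padic.measurableSet_region (p := p)
  rw [← integrable_indicator_iff hR, ← integral_indicator hR]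
  have hind : Set.indicator {q : ℚ_[p] × ℚ_[p] × ℚ_[p] × ℚ_[p] |
      (p ≤ ‖q.1‖ ∧ ‖q.2.1‖ < ‖q.1‖) ∧ ‖q.1 * q.2.2.1 - q.2.1 ^ 2‖ ≤ ‖q.1‖ ∧
        ‖q.2.2.2‖ < ‖q.1 + q.2.1 * q.2.2.2‖}
      (fun q ↦ (‖q.1 + q.2.1 * q.2.2.2‖ : ℂ) ^ (-1 - ν₁ + ν₂) *
        (‖q.1‖ : ℂ) ^ (-1 - ν₂) * θ (-q.2.2.2 - q.2.2.1)) =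
      fun q ↦ Padic.regionIntegrand θ (-1 - ν₁ + ν₂) ν₂ q.1 q.2.1 q.2.2.1 q.2.2.2 := by
    ext ⟨a, b, c, x⟩
    simp only [Set.indicator, Set.mem_ofPred_eq, Padic.regionIntegrand, cpowAbove]
    have hθcx : θ (-x - c) = θ (-c) * θ (-x) := by rw [← hθ_add]; congr 1; ring
    rw [hθcx]
    by_cases h1 : p ≤ ‖a‖ ∧ ‖b‖ < ‖a‖
    · by_cases h2 : ‖a * c - b ^ 2‖ ≤ ‖a‖
      · by_cases h3 : ‖x‖ < ‖a + b * x‖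
        · rw [if_pos ⟨h1, h2, h3⟩, if_pos h1, if_pos h2, if_pos h3]
          ring
        · rw [if_neg (fun h ↦ h3 h.2.2), if_neg h3]
          simp
      · rw [if_neg (fun h ↦ h2 h.2.1), if_neg h2]
        simp
    · rw [if_neg (fun h ↦ h1 h.1), if_neg h1]
      simp
  rw [hind]
  refine ⟨hθ.integrable_regionIntegrand hμ_norm hs h₂.le, ?_⟩
  rw [hθ.integral_regionIntegrand hμ_norm hs h₂.le]
  have hp : (p : ℂ) ≠ 0 := mod_cast (Fact.out : p.Prime).ne_zero
  have e1 : (p : ℂ) ^ (-1 - ν₂) * (p : ℂ) ^ (-1 - ν₁ + ν₂) = (p : ℂ)⁻¹ * (p : ℂ) ^ (-1 - ν₁) := by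
    rw [← Complex.cpow_neg_one, ← Complex.cpow_add _ _ hp, ← Complex.cpow_add _ _ hp]
    ring_nf
  have e2 : (p : ℂ) ^ (-1 - ν₁ + ν₂ - 2 * ν₂) * (p : ℂ) ^ (-1 - ν₁ + ν₂) =
      (p : ℂ) ^ (-2 - 2 * ν₁) := by
    rw [← Complex.cpow_add _ _ hp]
    ring_nf
  have e3 : (p : ℂ) ^ (-2 - 2 * ν₁) * (p : ℂ) ^ (-ν₂) = (p : ℂ) ^ (-2 - 2 * ν₁ - ν₂) := by
    rw [← Complex.cpow_add _ _ hp]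
    ring_nf
  have e4 : (p : ℂ) ^ (-2 - 2 * ν₁ - ν₂) * (p : ℂ) ^ (-1 - ν₁ + ν₂) = (p : ℂ) ^ (-3 - 3 * ν₁) := by
    rw [← Complex.cpow_add _ _ hp]
    ring_nf
  have e5 : (p - 1 : ℂ) * (p : ℂ)⁻¹ = 1 - (p : ℂ)⁻¹ := by field_simp
  rw [← e4, ← e3, ← e2, e1, ← e5]
  ring
end
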